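/- Let ν, μ > 0 with |ν − μ| > 1, and suppose that the least positive zero of Y_μ is smaller than the least positive zero of J_ν (both least zeros exist). Then the positive zeros of J_ν and Y_μ are NOT interlaced on (0,∞). -/

import Mathlib

open Real Filter Topology Set

/-- Bessel function of the first kind of real order `ν`:
`J_ν(x) = ∑ ((−1)^m / (m! Γ(m+ν+1))) (x/2)^{2m+ν}` (with `1/Γ = 0` at nonpositive
integers, which agrees with Lean's `1/0 = 0` since `Real.Gamma` vanishes there). -/
noncomputable def besselJ (ν : ℝ) (x : ℝ) : ℝ :=
  ∑' m : ℕ, ((-1 : ℝ) ^ m / (m.factorial * Real.Gamma ((m : ℝ) + ν + 1))) *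
    (x / 2) ^ (2 * (m : ℝ) + ν)

/-- Bessel function of the second kind, characterized as the limit
`(J_μ(x) cos(μπ) − J_{−μ}(x)) / sin(μπ) → Y_ν(x)` as `μ → ν` through non-integer reals. -/
noncomputable def besselY (ν : ℝ) (x : ℝ) : ℝ :=
  limUnder (𝓝[{μ : ℝ | ∀ n : ℤ, μ ≠ (n : ℝ)}] ν)
    (fun μ : ℝ => (besselJ μ x * Real.cos (μ * π) - besselJ (-μ) x) / Real.sin (μ * π))

/-- The cylinder function `C_ν(x) = cos δ · J_ν(x) − sin δ · Y_ν(x)`. -/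
noncomputable def cylinder (δ ν : ℝ) (x : ℝ) : ℝ :=
  Real.cos δ * besselJ ν x - Real.sin δ * besselY ν x

/-- One direction of the interlacing property: between any two consecutive zeros of `f`
in `I` there is exactly one zero of `g`. -/
def InterlaceHalf (f g : ℝ → ℝ) (I : Set ℝ) : Prop :=
  ∀ x₁ ∈ I, ∀ x₂ ∈ I, x₁ < x₂ → f x₁ = 0 → f x₂ = 0 →
    (∀ x ∈ Set.Ioo x₁ x₂, f x ≠ 0) →
    ∃! x, x ∈ Set.Ioo x₁ x₂ ∧ g x = 0

/-- `f` and `g` have interlaced zeros on `I`. -/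
def InterlacedOn (f g : ℝ → ℝ) (I : Set ℝ) : Prop :=
  InterlaceHalf f g I ∧ InterlaceHalf g f I

open Real Filter Topology Set

/-- A family of functions satisfying the two Bessel recurrences. -/
def Cyl (C : ℝ → ℝ → ℝ) : Prop := ∀ ν x, 0 < x →
  HasDerivAt (C ν) (ν / x * C ν x - C (ν + 1) x) x ∧
  HasDerivAt (C ν) (C (ν - 1) x - ν / x * C ν x) x

noncomputable def cP (ν : ℝ) (m : ℕ) : ℝ := (-1 : ℝ) ^ m / (m.factorial * Real.Gamma ((m : ℝ) + ν + 1))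

noncomputable def PB (ν w : ℝ) : ℝ := ∑' m : ℕ, cP ν m * w ^ m

lemma inv_Gamma_rec (s : ℝ) : s * (Real.Gamma (s + 1))⁻¹ = (Real.Gamma s)⁻¹ := by
  by_cases h : s = 0
  · subst h; simp [Real.Gamma_zero]
  · rw [Real.Gamma_add_one h, mul_inv]
    field_simp

lemma inv_Gamma_bdd (ν : ℝ) : ∃ K : ℝ, 0 ≤ K ∧ ∀ m : ℕ, |(Real.Gamma ((m : ℝ) + ν + 1))⁻¹| ≤ K := by
  obtain ⟨M, hM⟩ := exists_nat_ge (-ν)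
  have hstep : ∀ k : ℕ, |(Real.Gamma (((M + k : ℕ) : ℝ) + ν + 1))⁻¹| ≤ |(Real.Gamma ((M : ℝ) + ν + 1))⁻¹| := by
    intro k
    induction k with
    | zero => simp
    | succ k ih =>
      refine le_trans ?_ ih
      have h1 := inv_Gamma_rec (((M + k : ℕ) : ℝ) + ν + 1)
      have e : (((M + (k+1) : ℕ) : ℝ) + ν + 1) = (((M + k : ℕ) : ℝ) + ν + 1) + 1 := by push_cast; ring
      rw [e, ← h1, abs_mul]
      apply le_mul_of_one_le_left (abs_nonneg _)
      have : (1:ℝ) ≤ (((M + k : ℕ) : ℝ) + ν + 1) := by push_cast; linarith [(Nat.cast_nonneg k : (0:ℝ) ≤ k)]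
      exact le_trans this (le_abs_self _)
  refine ⟨∑ m ∈ Finset.range (M+1), |(Real.Gamma ((m : ℝ) + ν + 1))⁻¹|, Finset.sum_nonneg (fun _ _ => abs_nonneg _), ?_⟩
  intro m
  have hle : ∀ i, i < M + 1 → |(Real.Gamma ((i : ℝ) + ν + 1))⁻¹| ≤ ∑ m ∈ Finset.range (M+1), |(Real.Gamma ((m : ℝ) + ν + 1))⁻¹| := by
    intro i hi
    exact Finset.single_le_sum (f := fun m : ℕ => |(Real.Gamma ((m : ℝ) + ν + 1))⁻¹|) (fun _ _ => abs_nonneg _) (Finset.mem_range.2 hi)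
  rcases lt_or_ge m (M+1) with h | h
  · exact hle m h
  · obtain ⟨k, rfl⟩ := Nat.exists_eq_add_of_le (show M ≤ m by omega)
    exact (hstep k).trans (hle M (by omega))

lemma cP_bdd (ν : ℝ) : ∃ K : ℝ, 0 ≤ K ∧ ∀ m : ℕ, |cP ν m| ≤ K / m.factorial := by
  obtain ⟨K, hK, h⟩ := inv_Gamma_bdd ν
  refine ⟨K, hK, fun m => ?_⟩
  have : cP ν m = (-1)^m * (m.factorial : ℝ)⁻¹ * (Real.Gamma ((m : ℝ) + ν + 1))⁻¹ := by
    unfold cP; rw [div_eq_mul_inv, mul_inv, mul_assoc]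
  rw [this, abs_mul, abs_mul, abs_pow, abs_neg, abs_one, one_pow, one_mul, abs_inv, Nat.abs_cast, div_eq_inv_mul]
  gcongr
  exact h m

lemma PB_summable (ν w : ℝ) : Summable (fun m => cP ν m * w ^ m) := by
  obtain ⟨K, hK, h⟩ := cP_bdd ν
  refine Summable.of_norm_bounded (g := fun m : ℕ => K * (|w| ^ m / m.factorial)) ((Real.summable_pow_div_factorial |w|).mul_left K) ?_
  intro m
  rw [norm_mul, norm_pow, Real.norm_eq_abs, Real.norm_eq_abs]
  calc |cP ν m| * |w|^m ≤ K / m.factorial * |w|^m := by gcongr; exact h m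
    _ = _ := by ring

lemma cP_succ (ν : ℝ) (m : ℕ) : cP ν (m+1) * ((m:ℝ)+1) = - cP (ν+1) m := by
  unfold cP
  have e : (((m+1:ℕ):ℝ) + ν + 1) = (m:ℝ) + (ν+1) + 1 := by push_cast; ring
  rw [e, Nat.factorial_succ]
  have h1 : ((m:ℝ)+1) ≠ 0 := by positivity
  push_cast
  rw [div_mul_eq_mul_div, pow_succ, ← neg_div]
  rw [mul_assoc ((m:ℝ)+1), mul_comm ((m:ℝ)+1), mul_div_mul_right _ _ h1]
  ring

lemma PB_hasDerivAt (ν w : ℝ) : HasDerivAt (PB ν) (- PB (ν+1) w) w := by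
  obtain ⟨K, hK, h⟩ := cP_bdd ν
  set R := |w| + 1 with hR
  have hRp : 0 < R := by positivity
  have key := hasDerivAt_tsum_of_isPreconnected (𝕜 := ℝ) (g := fun (m:ℕ) (y:ℝ) => cP ν m * y ^ m)
    (g' := fun (m:ℕ) (y:ℝ) => cP ν m * (m * y ^ (m-1))) (u := fun m : ℕ => K * (m * R ^ (m-1) / m.factorial))
    (t := Metric.ball 0 R) (y₀ := 0) (y := w) ?_ Metric.isOpen_ball (convex_ball _ _).isPreconnected ?_ ?_ ?_ ?_ ?_
  · have e : (∑' m : ℕ, cP ν m * (m * w ^ (m-1))) = - PB (ν+1) w := by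
      rw [Summable.tsum_eq_zero_add]
      · unfold PB
        rw [← tsum_neg]
        simp only [Nat.cast_zero, zero_mul, mul_zero, zero_add]
        congr 1; ext m
        have := cP_succ ν m
        push_cast
        rw [← mul_assoc, this]; simp
      · rw [← summable_nat_add_iff 1]
        have := (PB_summable (ν+1) w).neg
        refine this.congr ?_
        intro m
        have := cP_succ ν m
        push_cast
        rw [← mul_assoc, this]; simp
    rw [← e]; exact key
  · apply Summable.mul_left
    rw [← summable_nat_add_iff 1]
    refine (Real.summable_pow_div_factorial R).congr ?_
    intro m
    rw [Nat.factorial_succ]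
    have h1 : ((m:ℝ)+1) ≠ 0 := by positivity
    push_cast
    rw [mul_div_mul_left _ _ h1]
  · intro m y hy
    exact (hasDerivAt_pow m y).const_mul _
  · intro m y hy
    rw [Metric.mem_ball, dist_zero_right, Real.norm_eq_abs] at hy
    rw [norm_mul, norm_mul, norm_pow, Real.norm_eq_abs, Real.norm_eq_abs, Real.norm_eq_abs, Nat.abs_cast]
    calc |cP ν m| * (m * |y|^(m-1)) ≤ K / m.factorial * (m * R^(m-1)) := by
          gcongr; exact h m
      _ = _ := by ring
  · exact Metric.mem_ball_self hRp
  · exact PB_summable ν 0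
  · rw [Metric.mem_ball, dist_zero_right, Real.norm_eq_abs]; linarith

lemma PB_rec (ν w : ℝ) : PB (ν-1) w = ν * PB ν w - w * PB (ν+1) w := by
  have h1 : ∀ m : ℕ, cP (ν-1) m = (m + ν) * cP ν m := by
    intro m
    have := inv_Gamma_rec (m + ν)
    unfold cP
    rw [show (m:ℝ) + (ν-1) + 1 = m + ν by ring]
    rw [div_eq_mul_inv, mul_inv, ← this]; ring
  have hs := PB_summable ν w
  have hs2 : Summable (fun m : ℕ => (m:ℝ) * cP ν m * w^m) := by
    have := (PB_summable (ν-1) w).sub (hs.mul_left ν)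
    refine this.congr fun m => ?_
    rw [h1]; ring
  have e : PB (ν-1) w = ν * PB ν w + ∑' m : ℕ, (m:ℝ) * cP ν m * w^m := by
    unfold PB
    rw [← tsum_mul_left, ← (hs.mul_left ν).tsum_add hs2]
    congr 1; ext m; rw [h1]; ring
  rw [e, hs2.tsum_eq_zero_add]
  have : (∑' m : ℕ, ((m+1:ℕ):ℝ) * cP ν (m+1) * w^(m+1)) = - (w * PB (ν+1) w) := by
    unfold PB
    rw [← tsum_mul_left, ← tsum_neg]
    congr 1; ext m
    have := cP_succ ν m
    push_cast
    linear_combination w^(m+1) * this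
  rw [this]; simp; ring

lemma besselJ_eq (ν : ℝ) {x : ℝ} (hx : 0 < x) : besselJ ν x = (x/2)^ν * PB ν ((x/2)^2) := by
  unfold besselJ PB
  rw [← tsum_mul_left]
  congr 1; ext m
  have h2 : 0 < x/2 := by positivity
  rw [Real.rpow_add h2, show (2 * (m:ℝ)) = ((2*m : ℕ):ℝ) by push_cast; ring, Real.rpow_natCast, pow_mul]
  unfold cP; ring

lemma besselJ_rec (ν : ℝ) {x : ℝ} (hx : 0 < x) : besselJ (ν-1) x = 2*ν/x * besselJ ν x - besselJ (ν+1) x := by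
  rw [besselJ_eq _ hx, besselJ_eq _ hx, besselJ_eq _ hx, PB_rec]
  have h2 : 0 < x/2 := by positivity
  rw [Real.rpow_sub h2, Real.rpow_add h2, Real.rpow_one]
  field_simp

lemma cyl_besselJ : Cyl besselJ := by
  intro ν x hx
  have h2 : 0 < x/2 := by positivity
  have h1 : HasDerivAt (besselJ ν) (ν / x * besselJ ν x - besselJ (ν + 1) x) x := by
    have hd : HasDerivAt (fun y : ℝ => (y/2)^ν * PB ν ((y/2)^2))
      (((1/2) * ν * (x/2)^(ν-1)) * PB ν ((x/2)^2) + (x/2)^ν * (- PB (ν+1) ((x/2)^2) * (x/2))) x := by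
      refine HasDerivAt.mul ?_ ?_
      · exact HasDerivAt.rpow_const ((hasDerivAt_id x).div_const 2) (Or.inl h2.ne')
      · have hin : HasDerivAt (fun y : ℝ => (y/2)^2) (x/2) x := by
          have := ((hasDerivAt_id x).div_const 2).pow 2
          refine this.congr_deriv ?_
          simp; ring
        exact (PB_hasDerivAt ν ((x/2)^2)).comp x hin
    have hev : besselJ ν =ᶠ[𝓝 x] (fun y : ℝ => (y/2)^ν * PB ν ((y/2)^2)) := by
      filter_upwards [lt_mem_nhds hx] with y hy
      exact besselJ_eq ν hy
    refine (hd.congr_of_eventuallyEq hev).congr_deriv ?_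
    rw [besselJ_eq _ hx, besselJ_eq _ hx, Real.rpow_sub h2, Real.rpow_add h2, Real.rpow_one]
    field_simp
    ring
  refine ⟨h1, h1.congr_deriv ?_⟩
  rw [besselJ_rec ν hx]; ring

lemma besselJ_lim (ν : ℝ) : Tendsto (fun x => x^(-ν) * besselJ ν x) (𝓝[>] 0) (𝓝 ((2:ℝ)^(-ν) * (Real.Gamma (ν+1))⁻¹)) := by
  have h0 : PB ν 0 = (Real.Gamma (ν+1))⁻¹ := by
    unfold PB
    rw [tsum_eq_single 0]
    · simp [cP]
    · intro m hm; simp [hm]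
  have hc : ContinuousAt (fun x : ℝ => (2:ℝ)^(-ν) * PB ν ((x/2)^2)) 0 := by
    apply ContinuousAt.mul continuousAt_const
    apply ContinuousAt.comp (f := fun x:ℝ => (x/2)^2) (g := PB ν)
    · exact (PB_hasDerivAt ν _).continuousAt
    · fun_prop
  have := (hc.tendsto).mono_left (nhdsWithin_le_nhds (s := Ioi 0))
  simp only [zero_div, ne_eq, OfNat.ofNat_ne_zero, not_false_eq_true, zero_pow, h0] at this
  refine this.congr' ?_
  filter_upwards [self_mem_nhdsWithin] with x hx
  have hx : 0 < x := hx
  rw [besselJ_eq _ hx, Real.div_rpow hx.le (by norm_num), Real.rpow_neg hx.le, Real.rpow_neg (by norm_num)]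
  have := (Real.rpow_pos_of_pos hx ν).ne'
  field_simp

open Real Filter Topology Set

noncomputable def AI (δ ν x : ℝ) : ℝ := ∫ θ in (0:ℝ)..π, Real.cos (x * Real.sin θ - ν * θ + δ)
noncomputable def BI (ν x : ℝ) : ℝ := ∫ t in Ioi (0:ℝ), Real.exp (-x * Real.sinh t - ν * t)
noncomputable def SI (ν x : ℝ) : ℝ := (AI 0 ν x - Real.sin (ν * π) * BI ν x) / π
noncomputable def TI (ν x : ℝ) : ℝ := (AI (-(π/2)) ν x - BI (-ν) x - Real.cos (ν * π) * BI ν x) / π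

lemma AI_hasDerivAt (δ ν x : ℝ) : HasDerivAt (AI δ ν) ((AI δ (ν-1) x - AI δ (ν+1) x)/2) x := by
  have h := intervalIntegral.hasDerivAt_integral_of_dominated_loc_of_deriv_le (μ := MeasureTheory.volume)
    (F := fun (x θ : ℝ) => Real.cos (x * Real.sin θ - ν * θ + δ))
    (F' := fun (x θ : ℝ) => - Real.sin (x * Real.sin θ - ν * θ + δ) * Real.sin θ) (x₀ := x) (s := univ) (a := 0) (b := π)
    (bound := fun _ => 1) univ_mem ?_ ?_ ?_ ?_ ?_ ?_
  · refine h.2.congr_deriv ?_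
    unfold AI
    rw [← intervalIntegral.integral_sub, ← intervalIntegral.integral_div]
    · congr 1; ext θ
      rw [show x * Real.sin θ - (ν-1) * θ + δ = (x * Real.sin θ - ν * θ + δ) + θ by ring,
        show x * Real.sin θ - (ν+1) * θ + δ = (x * Real.sin θ - ν * θ + δ) - θ by ring, Real.cos_add, Real.cos_sub]
      ring
    · exact (by fun_prop : Continuous _).intervalIntegrable _ _
    · exact (by fun_prop : Continuous _).intervalIntegrable _ _
  · exact Eventually.of_forall fun y => (by fun_prop : Continuous _).aestronglyMeasurable
  · exact (by fun_prop : Continuous _).intervalIntegrable _ _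
  · exact (by fun_prop : Continuous _).aestronglyMeasurable
  · refine Eventually.of_forall fun t _ y _ => ?_
    rw [norm_mul, norm_neg, Real.norm_eq_abs, Real.norm_eq_abs]
    exact mul_le_one₀ (Real.abs_sin_le_one _) (abs_nonneg _) (Real.abs_sin_le_one _)
  · exact intervalIntegrable_const
  · refine Eventually.of_forall fun t _ y _ => ?_
    have : HasDerivAt (fun y : ℝ => y * Real.sin t - ν * t + δ) (Real.sin t) y := by
      simpa using (((hasDerivAt_id y).mul_const (Real.sin t)).sub_const (ν*t)).add_const δ
    exact this.cos

lemma AI_rec (δ ν x : ℝ) : x/2 * (AI δ (ν-1) x + AI δ (ν+1) x) - ν * AI δ ν x = Real.sin (-(ν*π) + δ) - Real.sin δ := by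
  have h : ∫ θ in (0:ℝ)..π, Real.cos (x * Real.sin θ - ν * θ + δ) * (x * Real.cos θ - ν) = Real.sin (x * Real.sin π - ν * π + δ) - Real.sin (x * Real.sin 0 - ν * 0 + δ) := by
    apply intervalIntegral.integral_eq_sub_of_hasDerivAt (f := fun θ => Real.sin (x * Real.sin θ - ν * θ + δ))
    · intro θ _
      have : HasDerivAt (fun θ : ℝ => x * Real.sin θ - ν * θ + δ) (x * Real.cos θ - ν) θ := by
        simpa using (((Real.hasDerivAt_sin θ).const_mul x).sub ((hasDerivAt_id θ).const_mul ν)).add_const δ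
      exact this.sin
    · exact (by fun_prop : Continuous _).intervalIntegrable _ _
  simp only [Real.sin_pi, Real.sin_zero, mul_zero, sub_zero, zero_add, zero_sub] at h
  rw [← h]
  unfold AI
  rw [← intervalIntegral.integral_add, ← intervalIntegral.integral_const_mul, ← intervalIntegral.integral_const_mul, ← intervalIntegral.integral_sub]
  · congr 1; ext θ
    rw [show x * Real.sin θ - (ν-1) * θ + δ = (x * Real.sin θ - ν * θ + δ) + θ by ring,
        show x * Real.sin θ - (ν+1) * θ + δ = (x * Real.sin θ - ν * θ + δ) - θ by ring, Real.cos_add, Real.cos_sub]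
    ring
  all_goals exact (by fun_prop : Continuous _).intervalIntegrable _ _

lemma sinh_lower {t : ℝ} (ht : 0 ≤ t) : t^2/4 ≤ Real.sinh t := by
  have h1 := Real.quadratic_le_exp_of_nonneg ht
  have h2 : Real.exp (-t) ≤ 1 := Real.exp_le_one_iff.2 (by linarith)
  rw [Real.sinh_eq]; nlinarith

lemma BI_bound {ν x t x₀ N : ℝ} (hx0 : 0 < x₀) (hx : x₀ ≤ x) (hN : |ν| ≤ N) (ht : 0 ≤ t) :
    Real.exp (-x * Real.sinh t - ν * t) ≤ Real.exp ((1+N)^2/x₀) * Real.exp (-t) := by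
  rw [← Real.exp_add]
  apply Real.exp_le_exp.2
  have h1 := sinh_lower ht
  have h2 : x₀ * (t^2/4) ≤ x * Real.sinh t := by
    apply mul_le_mul hx h1 (by positivity) (by linarith)
  have h3 : -ν ≤ N := (neg_le_abs ν).trans hN
  have h4 : -ν * t ≤ N * t := by gcongr
  have h5 : (1+N)*t ≤ x₀ * (t^2/4) + (1+N)^2/x₀ := by
    have : x₀ * (t^2/4) + (1+N)^2/x₀ - (1+N)*t = (x₀ * t/2 - (1+N))^2/x₀ := by field_simp; ring
    have : 0 ≤ (x₀ * t/2 - (1+N))^2/x₀ := by positivity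
    linarith
  linarith

lemma exp_neg_intOn : MeasureTheory.IntegrableOn (fun t : ℝ => Real.exp (-t)) (Ioi 0) := by
  simpa using integrableOn_exp_neg_Ioi 0

lemma BI_intOn (ν : ℝ) {x : ℝ} (hx : 0 < x) : MeasureTheory.IntegrableOn (fun t => Real.exp (-x * Real.sinh t - ν * t)) (Ioi 0) := by
  refine MeasureTheory.Integrable.mono' (exp_neg_intOn.const_mul (Real.exp ((1+|ν|)^2/x))) ?_ ?_
  · exact (by fun_prop : Continuous _).aestronglyMeasurable
  · refine (MeasureTheory.ae_restrict_iff' measurableSet_Ioi).2 (Eventually.of_forall fun t ht => ?_)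
    rw [Real.norm_eq_abs, abs_of_pos (Real.exp_pos _)]
    exact BI_bound hx le_rfl le_rfl (le_of_lt ht)

lemma BI_hasDerivAt (ν : ℝ) {x : ℝ} (hx : 0 < x) : HasDerivAt (BI ν) ((BI (ν+1) x - BI (ν-1) x)/2) x := by
  have e : ∀ (y t : ℝ), - Real.sinh t * Real.exp (-y * Real.sinh t - ν * t) =
      (Real.exp (-y * Real.sinh t - (ν+1) * t) - Real.exp (-y * Real.sinh t - (ν-1) * t))/2 := by
    intro y t
    rw [show -y * Real.sinh t - (ν+1) * t = (-y * Real.sinh t - ν * t) + (-t) by ring,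
      show -y * Real.sinh t - (ν-1) * t = (-y * Real.sinh t - ν * t) + t by ring, Real.exp_add, Real.exp_add, Real.sinh_eq]
    ring
  have h := hasDerivAt_integral_of_dominated_loc_of_deriv_le (μ := MeasureTheory.volume.restrict (Ioi (0:ℝ)))
    (F := fun (x t : ℝ) => Real.exp (-x * Real.sinh t - ν * t))
    (F' := fun (x t : ℝ) => - Real.sinh t * Real.exp (-x * Real.sinh t - ν * t)) (x₀ := x) (s := Ioi (x/2))
    (bound := fun t => Real.exp ((1+(|ν|+1))^2/(x/2)) * Real.exp (-t)) (Ioi_mem_nhds (by linarith)) ?_ ?_ ?_ ?_ ?_ ?_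
  · refine h.2.congr_deriv ?_
    unfold BI
    simp_rw [e]
    rw [MeasureTheory.integral_div, MeasureTheory.integral_sub (BI_intOn _ hx) (BI_intOn _ hx)]
  · exact Eventually.of_forall fun y => (by fun_prop : Continuous _).aestronglyMeasurable
  · exact BI_intOn ν hx
  · exact (by fun_prop : Continuous _).aestronglyMeasurable
  · refine (MeasureTheory.ae_restrict_iff' measurableSet_Ioi).2 (Eventually.of_forall fun t ht y hy => ?_)
    have hy : x/2 < y := hy
    rw [e, Real.norm_eq_abs]
    have b1 := BI_bound (ν := ν+1) (N := |ν|+1) (half_pos hx) hy.le ((abs_add_le ν 1).trans (by simp)) (le_of_lt ht)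
    have b2 := BI_bound (ν := ν-1) (N := |ν|+1) (half_pos hx) hy.le ((abs_sub ν 1).trans (by simp)) (le_of_lt ht)
    have p1 := Real.exp_pos (-y * Real.sinh t - (ν+1) * t)
    have p2 := Real.exp_pos (-y * Real.sinh t - (ν-1) * t)
    rw [abs_le]; constructor <;> linarith
  · exact exp_neg_intOn.const_mul _
  · refine Eventually.of_forall fun t y _ => ?_
    have : HasDerivAt (fun y : ℝ => -y * Real.sinh t - ν * t) (-Real.sinh t) y := by
      simpa using (((hasDerivAt_id y).neg.mul_const (Real.sinh t)).sub_const (ν*t))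
    refine this.exp.congr_deriv ?_
    ring

lemma BI_rec (ν : ℝ) {x : ℝ} (hx : 0 < x) : x/2 * (BI (ν-1) x + BI (ν+1) x) + ν * BI ν x = 1 := by
  have e : ∀ (t : ℝ), Real.exp (-x * Real.sinh t - ν * t) * (-x * Real.cosh t - ν) =
      -(x/2 * (Real.exp (-x * Real.sinh t - (ν-1) * t) + Real.exp (-x * Real.sinh t - (ν+1) * t)) + ν * Real.exp (-x * Real.sinh t - ν * t)) := by
    intro t
    rw [show -x * Real.sinh t - (ν+1) * t = (-x * Real.sinh t - ν * t) + (-t) by ring,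
      show -x * Real.sinh t - (ν-1) * t = (-x * Real.sinh t - ν * t) + t by ring, Real.exp_add, Real.exp_add, Real.cosh_eq]
    ring
  have hi : MeasureTheory.IntegrableOn (fun t => (x/2 * (Real.exp (-x * Real.sinh t - (ν-1) * t) + Real.exp (-x * Real.sinh t - (ν+1) * t)) + ν * Real.exp (-x * Real.sinh t - ν * t))) (Ioi 0) :=
    (((BI_intOn _ hx).add (BI_intOn _ hx)).const_mul _).add ((BI_intOn _ hx).const_mul _)
  have h := MeasureTheory.integral_Ioi_of_hasDerivAt_of_tendsto' (f := fun t => Real.exp (-x * Real.sinh t - ν * t))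
    (f' := fun t => -(x/2 * (Real.exp (-x * Real.sinh t - (ν-1) * t) + Real.exp (-x * Real.sinh t - (ν+1) * t)) + ν * Real.exp (-x * Real.sinh t - ν * t)))
    (a := 0) (m := 0) ?_ hi.neg ?_
  · rw [MeasureTheory.integral_neg, MeasureTheory.integral_add, MeasureTheory.integral_const_mul, MeasureTheory.integral_add (BI_intOn _ hx) (BI_intOn _ hx), MeasureTheory.integral_const_mul] at h
    · simp only [Real.sinh_zero, mul_zero, sub_zero, Real.exp_zero] at h
      unfold BI; linarith
    · exact ((BI_intOn _ hx).add (BI_intOn _ hx)).const_mul _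
    · exact (BI_intOn _ hx).const_mul _
  · intro t _
    rw [← e]
    have : HasDerivAt (fun t : ℝ => -x * Real.sinh t - ν * t) (-x * Real.cosh t - ν) t := by
      exact (((Real.hasDerivAt_sinh t).const_mul (-x)).sub ((hasDerivAt_id t).const_mul ν)).congr_deriv (by simp)
    exact this.exp
  · refine squeeze_zero' (Eventually.of_forall fun t => (Real.exp_pos _).le) (g := fun t => Real.exp ((1+|ν|)^2/x) * Real.exp (-t)) ?_ ?_
    · filter_upwards [eventually_ge_atTop 0] with t ht
      exact BI_bound hx le_rfl le_rfl ht
    · simpa using (Real.tendsto_exp_neg_atTop_nhds_zero).const_mul (Real.exp ((1+|ν|)^2/x))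

lemma sin_sub_one_mul_pi (ν : ℝ) : Real.sin ((ν-1)*π) = - Real.sin (ν*π) := by
  rw [sub_mul, one_mul, Real.sin_sub_pi]
lemma sin_add_one_mul_pi (ν : ℝ) : Real.sin ((ν+1)*π) = - Real.sin (ν*π) := by
  rw [add_mul, one_mul, Real.sin_add_pi]
lemma cos_sub_one_mul_pi (ν : ℝ) : Real.cos ((ν-1)*π) = - Real.cos (ν*π) := by
  rw [sub_mul, one_mul, Real.cos_sub_pi]
lemma cos_add_one_mul_pi (ν : ℝ) : Real.cos ((ν+1)*π) = - Real.cos (ν*π) := by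
  rw [add_mul, one_mul, Real.cos_add_pi]

lemma cyl_of (C : ℝ → ℝ → ℝ) (h1 : ∀ ν x, 0 < x → HasDerivAt (C ν) ((C (ν-1) x - C (ν+1) x)/2) x)
    (h2 : ∀ ν x, 0 < x → x/2 * (C (ν-1) x + C (ν+1) x) - ν * C ν x = 0) : Cyl C := by
  intro ν x hx
  have e : ν / x * C ν x = (C (ν-1) x + C (ν+1) x)/2 := by
    have := h2 ν x hx
    field_simp
    linarith
  constructor
  · refine (h1 ν x hx).congr_deriv ?_
    rw [e]; ring
  · refine (h1 ν x hx).congr_deriv ?_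
    rw [e]; ring

lemma cyl_SI : Cyl SI := by
  apply cyl_of
  · intro ν x hx
    refine (((AI_hasDerivAt 0 ν x).sub ((BI_hasDerivAt ν hx).const_mul (Real.sin (ν*π)))).div_const π).congr_deriv ?_
    unfold SI
    rw [sin_sub_one_mul_pi, sin_add_one_mul_pi]
    ring
  · intro ν x hx
    have h1 := AI_rec 0 ν x
    have h2 := BI_rec ν hx
    unfold SI
    rw [sin_sub_one_mul_pi, sin_add_one_mul_pi]
    rw [add_zero, Real.sin_neg, Real.sin_zero] at h1
    field_simp
    linear_combination 2 * h1 + 2 * Real.sin (ν*π) * h2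

lemma cyl_TI : Cyl TI := by
  apply cyl_of
  · intro ν x hx
    refine ((((AI_hasDerivAt (-(π/2)) ν x).sub (BI_hasDerivAt (-ν) hx)).sub ((BI_hasDerivAt ν hx).const_mul (Real.cos (ν*π)))).div_const π).congr_deriv ?_
    unfold TI
    rw [cos_sub_one_mul_pi, cos_add_one_mul_pi, show -(ν-1) = -ν+1 by ring, show -(ν+1) = -ν-1 by ring]
    ring
  · intro ν x hx
    have h1 := AI_rec (-(π/2)) ν x
    have h2 := BI_rec ν hx
    have h3 := BI_rec (-ν) hx
    unfold TI
    rw [cos_sub_one_mul_pi, cos_add_one_mul_pi, show -(ν-1) = -ν+1 by ring, show -(ν+1) = -ν-1 by ring]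
    rw [← sub_eq_add_neg, Real.sin_sub_pi_div_two, Real.cos_neg, Real.sin_neg, Real.sin_pi_div_two] at h1
    generalize Real.cos (ν*π) = c at *
    field_simp
    linear_combination 2 * h1 + 2 * c * h2 - 2 * h3

lemma AI_abs_le (δ ν x : ℝ) : |AI δ ν x| ≤ π := by
  have := intervalIntegral.norm_integral_le_of_norm_le_const (a := 0) (b := π) (C := 1) (f := fun θ => Real.cos (x * Real.sin θ - ν * θ + δ))
    (fun θ _ => by rw [Real.norm_eq_abs]; exact Real.abs_cos_le_one _)
  rw [Real.norm_eq_abs, sub_zero, abs_of_pos Real.pi_pos, one_mul] at this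
  exact this

lemma BI_nonneg (ν x : ℝ) : 0 ≤ BI ν x :=
  MeasureTheory.integral_nonneg fun _ => (Real.exp_pos _).le

lemma BI_le {ν x : ℝ} (hx : 0 < x) (h : 0 < ν + x) : BI ν x ≤ 1/(ν+x) := by
  have h1 : ∫ t in Ioi (0:ℝ), Real.exp (-(ν+x) * t) = 1/(ν+x) := by
    rw [integral_exp_mul_Ioi (by linarith)]; simp only [mul_zero, Real.exp_zero]; rw [neg_div_neg_eq]
  rw [← h1]
  apply MeasureTheory.setIntegral_mono_on (BI_intOn _ hx) _ measurableSet_Ioi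
  · intro t ht
    apply Real.exp_le_exp.2
    have : t ≤ Real.sinh t := Real.self_le_sinh_iff.2 (le_of_lt ht)
    nlinarith
  · exact integrableOn_exp_mul_Ioi (by linarith) 0

lemma BI_le' {ν x : ℝ} (hx : 0 < x) (h : 0 < ν) : BI ν x ≤ 1/ν := by
  refine (BI_le hx (by linarith)).trans ?_
  apply one_div_le_one_div_of_le h; linarith

open Real Filter Topology Set

noncomputable def GI (m x : ℝ) : ℝ := ∫ t in Ioi (0:ℝ), Real.exp (-x * (Real.exp t / 2) + m * t)

lemma sinh_le_half (t : ℝ) : Real.sinh t ≤ Real.exp t / 2 := by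
  rw [Real.sinh_eq]; have := Real.exp_pos (-t); linarith

lemma GI_intOn (m : ℝ) {x : ℝ} (hx : 0 < x) : MeasureTheory.IntegrableOn (fun t => Real.exp (-x * (Real.exp t / 2) + m * t)) (Ioi 0) := by
  refine MeasureTheory.Integrable.mono' (BI_intOn (-m) hx) ?_ ?_
  · exact (by fun_prop : Continuous _).aestronglyMeasurable
  · refine Eventually.of_forall fun t => ?_
    rw [Real.norm_eq_abs, abs_of_pos (Real.exp_pos _)]
    apply Real.exp_le_exp.2
    have := sinh_le_half t
    nlinarith

lemma GI_eq (m : ℝ) (hm : 0 < m) {x : ℝ} (hx : 0 < x) :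
    (x/2)^m * GI m x = ∫ u in Ioi (x/2), Real.exp (-u) * u^(m-1) := by
  have hpt : ∀ t : ℝ, ((fun u => Real.exp (-u) * u^(m-1)) ∘ fun t => x/2 * Real.exp t) t * (x/2 * Real.exp t)
      = (x/2)^m * Real.exp (-x * (Real.exp t / 2) + m * t) := by
    intro t
    simp only [Function.comp]
    have h0 : 0 < x/2 * Real.exp t := by positivity
    have h1 : (x/2 * Real.exp t)^(m-1) * (x/2 * Real.exp t) = (x/2)^m * Real.exp (m*t) := by
      have h2 := Real.rpow_add_one h0.ne' (m-1)
      rw [← h2, sub_add_cancel, Real.mul_rpow (by positivity) (Real.exp_pos _).le, ← Real.exp_mul, mul_comm t]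
    rw [mul_assoc, h1, Real.exp_add, show -x * (Real.exp t / 2) = -(x/2*Real.exp t) by ring]
    ring
  have key := MeasureTheory.integral_comp_mul_deriv_Ioi (f := fun t => x/2 * Real.exp t) (f' := fun t => x/2 * Real.exp t)
    (g := fun u => Real.exp (-u) * u^(m-1)) (a := 0) ?_ ?_ ?_ ?_ ?_ ?_
  · simp only [Real.exp_zero, mul_one] at key
    rw [← key, GI, ← MeasureTheory.integral_const_mul]
    congr 1
    ext t
    exact (hpt t).symm
  · fun_prop
  · exact Tendsto.const_mul_atTop (by positivity) Real.tendsto_exp_atTop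
  · intro t _
    exact ((Real.hasDerivAt_exp t).const_mul _).hasDerivWithinAt
  · rintro _ ⟨t, _, rfl⟩
    have h0 : 0 < x/2 * Real.exp t := by positivity
    apply ContinuousAt.continuousWithinAt
    exact (by fun_prop : ContinuousAt (fun u : ℝ => Real.exp (-u)) _).mul (Real.continuousAt_rpow_const _ _ (Or.inl h0.ne'))
  · refine (Real.GammaIntegral_convergent hm).mono_set ?_
    rintro _ ⟨t, _, rfl⟩
    exact (by positivity : 0 < x/2 * Real.exp t)
  · rw [integrableOn_Ici_iff_integrableOn_Ioi]
    simp_rw [hpt]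
    exact (GI_intOn m hx).const_mul _

lemma tail_lim (m : ℝ) (hm : 0 < m) : Tendsto (fun x : ℝ => ∫ u in Ioi (x/2), Real.exp (-u) * u^(m-1)) (𝓝[>] 0) (𝓝 (Real.Gamma m)) := by
  have ha : Tendsto (fun x : ℝ => x/2) (𝓝[>] 0) (𝓝 0) := by
    have : Tendsto (fun x : ℝ => x/2) (𝓝 0) (𝓝 (0/2)) := (continuous_id.div_const 2).tendsto 0
    rw [zero_div] at this
    exact this.mono_left nhdsWithin_le_nhds
  have h := (MeasureTheory.aecover_Ioi_of_Ioi (μ := MeasureTheory.volume) ha).integral_tendsto_of_countably_generated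
    (Real.GammaIntegral_convergent hm)
  rw [← Real.Gamma_eq_integral hm] at h
  refine h.congr' ?_
  filter_upwards [self_mem_nhdsWithin] with x hx
  rw [MeasureTheory.Measure.restrict_restrict measurableSet_Ioi]
  congr 2
  ext u
  simp only [mem_inter_iff, mem_Ioi]
  have : (0:ℝ) < x := hx
  constructor
  · exact fun h => h.1
  · exact fun h => ⟨h, by linarith⟩

lemma BI_GI (m : ℝ) {x : ℝ} (hx : 0 < x) : GI m x ≤ BI (-m) x ∧ BI (-m) x ≤ Real.exp (x/2) * GI m x := by
  constructor
  · apply MeasureTheory.setIntegral_mono_on (GI_intOn m hx) (BI_intOn _ hx) measurableSet_Ioi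
    intro t _
    apply Real.exp_le_exp.2
    have := sinh_le_half t
    nlinarith
  · unfold GI
    rw [← MeasureTheory.integral_const_mul]
    apply MeasureTheory.setIntegral_mono_on (BI_intOn _ hx) ((GI_intOn m hx).const_mul _) measurableSet_Ioi
    intro t ht
    rw [← Real.exp_add]
    apply Real.exp_le_exp.2
    have h2 : Real.exp (-t) ≤ 1 := Real.exp_le_one_iff.2 (by have : (0:ℝ) < t := ht; linarith)
    rw [Real.sinh_eq]
    nlinarith

lemma BI_lim (m : ℝ) (hm : 0 < m) : Tendsto (fun x : ℝ => x^m * BI (-m) x) (𝓝[>] 0) (𝓝 (2^m * Real.Gamma m)) := by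
  have h1 : Tendsto (fun x : ℝ => x^m * GI m x) (𝓝[>] 0) (𝓝 (2^m * Real.Gamma m)) := by
    refine ((tail_lim m hm).const_mul (2^m)).congr' ?_
    filter_upwards [self_mem_nhdsWithin] with x hx
    have hx : (0:ℝ) < x := hx
    rw [← GI_eq m hm hx, Real.div_rpow hx.le (by norm_num)]
    field_simp
  have h2 : Tendsto (fun x : ℝ => Real.exp (x/2)) (𝓝[>] 0) (𝓝 1) := by
    have : Tendsto (fun x : ℝ => Real.exp (x/2)) (𝓝 0) (𝓝 (Real.exp (0/2))) := (by fun_prop : Continuous fun x : ℝ => Real.exp (x/2)).tendsto 0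
    rw [zero_div, Real.exp_zero] at this
    exact this.mono_left nhdsWithin_le_nhds
  have h3 := h2.mul h1
  rw [one_mul] at h3
  refine tendsto_of_tendsto_of_tendsto_of_le_of_le' h1 h3 ?_ ?_
  · filter_upwards [self_mem_nhdsWithin] with x hx
    have hx : (0:ℝ) < x := hx
    exact mul_le_mul_of_nonneg_left (BI_GI m hx).1 (by positivity)
  · filter_upwards [self_mem_nhdsWithin] with x hx
    have hx : (0:ℝ) < x := hx
    have := mul_le_mul_of_nonneg_left (BI_GI m hx).2 (by positivity : 0 ≤ x^m)
    linarith [this, mul_left_comm (x^m) (Real.exp (x/2)) (GI m x)]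

lemma rpow_lim_zero {m : ℝ} (hm : 0 < m) : Tendsto (fun x : ℝ => x^m) (𝓝[>] 0) (𝓝 0) := by
  have := (Real.continuousAt_rpow_const 0 m (Or.inr hm.le)).tendsto
  rw [Real.zero_rpow hm.ne'] at this
  exact this.mono_left nhdsWithin_le_nhds

/-- order in `(-1,0)`. -/
lemma SI_lim_neg (m : ℝ) (hm : 0 < m) (hm1 : m < 1) :
    Tendsto (fun x : ℝ => x^m * SI (-m) x) (𝓝[>] 0) (𝓝 (2^m * (Real.Gamma (-m+1))⁻¹)) := by
  have h1 : Tendsto (fun x : ℝ => x^m * AI 0 (-m) x) (𝓝[>] 0) (𝓝 0) := by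
    have h := (rpow_lim_zero hm).mul_const π
    rw [zero_mul] at h
    refine squeeze_zero_norm' ?_ h
    filter_upwards [self_mem_nhdsWithin] with x hx
    have hx : (0:ℝ) < x := hx
    rw [norm_mul, Real.norm_eq_abs, Real.norm_eq_abs, abs_of_pos (by positivity : 0 < x^m)]
    exact mul_le_mul_of_nonneg_left (AI_abs_le _ _ _) (by positivity)
  have h2 := (h1.sub ((BI_lim m hm).const_mul (Real.sin (-m*π)))).div_const π
  have e : (0 - Real.sin (-m*π) * (2^m * Real.Gamma m)) / π = 2^m * (Real.Gamma (-m+1))⁻¹ := by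
    have r := Real.Gamma_mul_Gamma_one_sub m
    have s0 : 0 < Real.sin (π * m) := Real.sin_pos_of_pos_of_lt_pi (by positivity) (by nlinarith [Real.pi_pos])
    have g0 : 0 < Real.Gamma (1-m) := Real.Gamma_pos_of_pos (by linarith)
    rw [show -m+1 = 1-m by ring, show -m*π = -(π*m) by ring, Real.sin_neg]
    have := Real.pi_pos
    rw [eq_div_iff s0.ne'] at r
    field_simp
    linear_combination (2^m) * r
  rw [e] at h2
  refine h2.congr fun x => ?_
  unfold SI; ring

lemma AI_cont (δ ν : ℝ) : Continuous (AI δ ν) := by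
  refine continuous_iff_continuousAt.2 fun x => (AI_hasDerivAt δ ν x).continuousAt

lemma SI_lim_zero : Tendsto (fun x : ℝ => SI 0 x) (𝓝[>] 0) (𝓝 1) := by
  have h := ((AI_cont 0 0).tendsto 0).div_const π
  have e : AI 0 0 0 / π = 1 := by
    unfold AI; simp [Real.pi_pos.ne']
  rw [e] at h
  refine (h.mono_left nhdsWithin_le_nhds).congr fun x => ?_
  unfold SI; simp

open Real Filter Topology Set

lemma Cyl.sub {C D : ℝ → ℝ → ℝ} (hC : Cyl C) (hD : Cyl D) : Cyl (fun ν x => C ν x - D ν x) := by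
  intro ν x hx
  exact ⟨((hC ν x hx).1.sub (hD ν x hx).1).congr_deriv (by ring), ((hC ν x hx).2.sub (hD ν x hx).2).congr_deriv (by ring)⟩

lemma Cyl.lhop {f : ℝ → ℝ → ℝ} (hf : Cyl f) {a : ℝ} (ha : -1 < a)
    (h0 : Tendsto (fun x => x^(-a) * f a x) (𝓝[>] 0) (𝓝 0))
    (h1 : Tendsto (fun x => x^(a+1) * f (a+1) x) (𝓝[>] 0) (𝓝 0)) :
    Tendsto (fun x => x^(-(a+1)) * f (a+1) x) (𝓝[>] 0) (𝓝 0) := by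
  have key := HasDerivAt.lhopital_zero_nhdsGT (a := 0) (l := 𝓝 0) (f := fun x => x^(a+1) * f (a+1) x) (f' := fun x => x^(a+1) * f a x)
    (g := fun x => x^(2*a+2)) (g' := fun x => (2*a+2) * x^(2*a+2-1)) ?_ ?_ ?_ h1 (rpow_lim_zero (by linarith)) ?_
  · refine key.congr' ?_
    filter_upwards [self_mem_nhdsWithin] with x hx
    have hx : (0:ℝ) < x := hx
    rw [show -(a+1) = (a+1) - (2*a+2) by ring, Real.rpow_sub hx]
    ring
  · filter_upwards [self_mem_nhdsWithin] with x hx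
    have hx : (0:ℝ) < x := hx
    have h := (hf (a+1) x hx).2
    rw [add_sub_cancel_right] at h
    refine ((Real.hasDerivAt_rpow_const (Or.inl hx.ne')).mul h).congr_deriv ?_
    rw [Real.rpow_sub hx, Real.rpow_one]
    field_simp
    ring
  · filter_upwards [self_mem_nhdsWithin] with x hx
    have hx : (0:ℝ) < x := hx
    exact (Real.hasDerivAt_rpow_const (Or.inl hx.ne'))
  · filter_upwards [self_mem_nhdsWithin] with x hx
    have hx : (0:ℝ) < x := hx
    have : 0 < 2*a+2 := by linarith
    positivity
  · have h := h0.div_const (2*a+2)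
    rw [zero_div] at h
    refine h.congr' ?_
    filter_upwards [self_mem_nhdsWithin] with x hx
    have hx : (0:ℝ) < x := hx
    have : 0 < 2*a+2 := by linarith
    rw [show -a = (a+1) - (2*a+2-1) by ring, Real.rpow_sub hx]
    field_simp

lemma Cyl.energy {f : ℝ → ℝ → ℝ} (hf : Cyl f) {ν : ℝ} (hν : 0 < ν)
    (h0 : Tendsto (fun x => x^(-ν) * f ν x) (𝓝[>] 0) (𝓝 0))
    (h1 : Tendsto (fun x => x^(-(ν+1)) * f (ν+1) x) (𝓝[>] 0) (𝓝 0)) :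
    ∀ x, 0 < x → f ν x = 0 := by
  set E : ℝ → ℝ := fun x => x^(-(2*ν)) * (f ν x ^2 + f (ν+1) x ^2) with hE
  have hd : ∀ x, 0 < x → HasDerivAt E (-(x^(-(2*ν)) * ((4*ν+2)/x) * f (ν+1) x ^2)) x := by
    intro x hx
    have h := (hf (ν+1) x hx).2
    rw [add_sub_cancel_right] at h
    refine ((Real.hasDerivAt_rpow_const (p := -(2*ν)) (Or.inl hx.ne')).mul (((hf ν x hx).1.pow 2).add (h.pow 2))).congr_deriv ?_
    simp only [Pi.pow_apply, Pi.add_apply]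
    rw [Real.rpow_sub hx, Real.rpow_one]
    field_simp
    push_cast
    ring
  have hanti : AntitoneOn E (Ioi 0) := by
    apply antitoneOn_of_deriv_nonpos (convex_Ioi 0)
    · exact fun x hx => (hd x hx).continuousAt.continuousWithinAt
    · rw [interior_Ioi]; exact fun x hx => (hd x hx).differentiableAt.differentiableWithinAt
    · rw [interior_Ioi]; intro x hx
      rw [(hd x hx).deriv]
      have hx : (0:ℝ) < x := hx
      have : 0 ≤ x^(-(2*ν)) * ((4*ν+2)/x) * f (ν+1) x ^2 := by positivity
      linarith
  have hlim : Tendsto E (𝓝[>] 0) (𝓝 0) := by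
    have hx2 : Tendsto (fun x : ℝ => x) (𝓝[>] 0) (𝓝 0) := tendsto_id.mono_left nhdsWithin_le_nhds
    have h := (h0.pow 2).add ((hx2.mul h1).pow 2)
    simp only [ne_eq, OfNat.ofNat_ne_zero, not_false_eq_true, zero_pow, mul_zero, add_zero] at h
    refine h.congr' ?_
    filter_upwards [self_mem_nhdsWithin] with x hx
    have hx : (0:ℝ) < x := hx
    rw [hE]
    have e1 : x^(-(ν+1)) = x^(-ν) / x := by rw [show -(ν+1) = -ν - 1 by ring, Real.rpow_sub hx, Real.rpow_one]
    have e2 : x^(-(2*ν)) = (x^(-ν))^2 := by rw [show -(2*ν) = -ν + -ν by ring, Real.rpow_add hx]; ring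
    simp only
    rw [e1, e2]
    field_simp
  intro x hx
  have hle : E x ≤ 0 := by
    refine ge_of_tendsto hlim ?_
    filter_upwards [Ioo_mem_nhdsGT hx] with y hy
    exact hanti hy.1 hx hy.2.le
  have hp : 0 < x^(-(2*ν)) := by positivity
  have h3 : f ν x ^2 + f (ν+1) x ^2 ≤ 0 := by
    by_contra hc
    push Not at hc
    have := mul_pos hp hc
    linarith
  nlinarith [sq_nonneg (f ν x), sq_nonneg (f (ν+1) x)]

lemma Cyl.up {f : ℝ → ℝ → ℝ} (hf : Cyl f) {ν : ℝ} (h : ∀ x, 0 < x → f ν x = 0) : ∀ x, 0 < x → f (ν+1) x = 0 := by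
  intro x hx
  have h1 := (hf ν x hx).1
  have h2 : HasDerivAt (f ν) 0 x := by
    refine (hasDerivAt_const x (0:ℝ)).congr_of_eventuallyEq ?_
    filter_upwards [Ioi_mem_nhds hx] with y hy using h y hy
  have := h1.unique h2
  rw [h x hx] at this
  linarith

lemma Cyl.down {f : ℝ → ℝ → ℝ} (hf : Cyl f) {ν : ℝ} (h : ∀ x, 0 < x → f ν x = 0) : ∀ x, 0 < x → f (ν-1) x = 0 := by
  intro x hx
  have h1 := (hf ν x hx).2
  have h2 : HasDerivAt (f ν) 0 x := by
    refine (hasDerivAt_const x (0:ℝ)).congr_of_eventuallyEq ?_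
    filter_upwards [Ioi_mem_nhds hx] with y hy using h y hy
  have := h1.unique h2
  rw [h x hx] at this
  linarith

lemma Cyl.all {f : ℝ → ℝ → ℝ} (hf : Cyl f) (h : ∀ ν x, 0 < ν → ν ≤ 1 → 0 < x → f ν x = 0) : ∀ ν x, 0 < x → f ν x = 0 := by
  have hup : ∀ n : ℕ, ∀ ν x, 0 < ν → ν ≤ 1 → 0 < x → f (ν + n) x = 0 := by
    intro n
    induction n with
    | zero => intro ν x h1 h2 h3; simpa using h ν x h1 h2 h3
    | succ n ih =>
      intro ν x h1 h2 h3
      have := hf.up (fun x hx => ih ν x h1 h2 hx) x h3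
      rw [show ν + ((n+1:ℕ):ℝ) = ν + n + 1 by push_cast; ring]; exact this
  have hdn : ∀ n : ℕ, ∀ ν x, 0 < ν → ν ≤ 1 → 0 < x → f (ν - n) x = 0 := by
    intro n
    induction n with
    | zero => intro ν x h1 h2 h3; simpa using h ν x h1 h2 h3
    | succ n ih =>
      intro ν x h1 h2 h3
      have := hf.down (fun x hx => ih ν x h1 h2 hx) x h3
      rw [show ν - ((n+1:ℕ):ℝ) = ν - n - 1 by push_cast; ring]; exact this
  intro ν x hx
  set k : ℤ := ⌈ν⌉ - 1 with hk
  have hk1 : (k:ℝ) < ν := by have := Int.ceil_lt_add_one ν; rw [hk]; push_cast; linarith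
  have hk2 : ν ≤ k + 1 := by have := Int.le_ceil ν; rw [hk]; push_cast; linarith
  rcases Int.eq_nat_or_neg k with ⟨n, hn | hn⟩
  · have := hup n (ν - k) x (by linarith) (by linarith) hx
    rw [hn] at this
    simpa using this
  · have := hdn n (ν - k) x (by linarith) (by linarith) hx
    rw [hn] at this
    simpa using this

lemma SI_bdd {ν x : ℝ} (hν : 0 < ν) (hx : 0 < x) : |SI ν x| ≤ 1 + 1/ν := by
  have h1 := AI_abs_le 0 ν x
  have h2 := BI_le' hx hν
  have h3 := BI_nonneg ν x
  have hp := Real.pi_gt_three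
  unfold SI
  rw [abs_div, abs_of_pos Real.pi_pos, div_le_iff₀ Real.pi_pos]
  have h4 : |Real.sin (ν*π) * BI ν x| ≤ 1/ν := by
    rw [abs_mul, abs_of_nonneg h3]
    have := mul_le_mul_of_nonneg_right (Real.abs_sin_le_one (ν*π)) h3
    linarith
  have h5 := abs_sub (AI 0 ν x) (Real.sin (ν*π) * BI ν x)
  have h6 : 0 < 1/ν := by positivity
  nlinarith

lemma SI_small {ν : ℝ} (hν : 0 < ν) : Tendsto (fun x => x^ν * (SI ν x - besselJ ν x)) (𝓝[>] 0) (𝓝 0) := by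
  have h1 : Tendsto (fun x => x^ν * SI ν x) (𝓝[>] 0) (𝓝 0) := by
    have h := (rpow_lim_zero hν).mul_const (1+1/ν)
    rw [zero_mul] at h
    refine squeeze_zero_norm' ?_ h
    filter_upwards [self_mem_nhdsWithin] with x hx
    have hx : (0:ℝ) < x := hx
    rw [norm_mul, Real.norm_eq_abs, Real.norm_eq_abs, abs_of_pos (by positivity : 0 < x^ν)]
    exact mul_le_mul_of_nonneg_left (SI_bdd hν hx) (by positivity)
  have h2 := (rpow_lim_zero (by linarith : 0 < ν + ν)).mul (besselJ_lim ν)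
  rw [zero_mul] at h2
  have h3 := h1.sub h2
  rw [sub_zero] at h3
  refine h3.congr' ?_
  filter_upwards [self_mem_nhdsWithin] with x hx
  have hx : (0:ℝ) < x := hx
  rw [Real.rpow_add hx, Real.rpow_neg hx.le]
  field_simp

lemma SI_eq_J_aux (ν x : ℝ) (h0 : 0 < ν) (h1 : ν ≤ 1) (hx : 0 < x) : SI ν x - besselJ ν x = 0 := by
  have hC := cyl_SI.sub cyl_besselJ
  obtain ⟨a, rfl⟩ : ∃ a, ν = a + 1 := ⟨ν - 1, by ring⟩
  have ha : -1 < a := by linarith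
  have hl0 : Tendsto (fun x => x^(-a) * (SI a x - besselJ a x)) (𝓝[>] 0) (𝓝 0) := by
    have hS : Tendsto (fun x => x^(-a) * SI a x) (𝓝[>] 0) (𝓝 ((2:ℝ)^(-a) * (Real.Gamma (a+1))⁻¹)) := by
      rcases eq_or_lt_of_le (by linarith : a ≤ 0) with h | h
      · subst h
        simpa using SI_lim_zero
      · simpa using SI_lim_neg (-a) (by linarith) (by linarith)
    have := hS.sub (besselJ_lim a)
    rw [sub_self] at this
    refine this.congr fun x => by ring
  have hl1 := hC.lhop ha hl0 (SI_small h0)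
  have hl2 := hC.lhop (by linarith) hl1 (SI_small (by linarith))
  exact hC.energy h0 hl1 hl2 x hx

lemma SI_eq_J (ν : ℝ) {x : ℝ} (hx : 0 < x) : besselJ ν x = SI ν x := by
  have := (cyl_SI.sub cyl_besselJ).all SI_eq_J_aux ν x hx
  linarith

open Real Filter Topology Set

lemma AI_neg (μ x : ℝ) : AI 0 (-μ) x = Real.cos (μ*π) * AI 0 μ x - Real.sin (μ*π) * AI (-(π/2)) μ x := by
  unfold AI
  have h := intervalIntegral.integral_comp_sub_left (a := 0) (b := π) (fun θ => Real.cos (x * Real.sin θ - -μ * θ + 0)) π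
  rw [sub_self, sub_zero] at h
  rw [← h, ← intervalIntegral.integral_const_mul, ← intervalIntegral.integral_const_mul, ← intervalIntegral.integral_sub]
  · congr 1
    ext θ
    rw [Real.sin_pi_sub, show x * Real.sin θ - μ * θ + -(π/2) = (x * Real.sin θ - μ * θ) - π/2 by ring, Real.cos_sub_pi_div_two,
      show x * Real.sin θ - -μ * (π - θ) + 0 = (μ * π) + (x * Real.sin θ - μ * θ) by ring, Real.cos_add, add_zero]
  · exact (by fun_prop : Continuous _).intervalIntegrable _ _
  · exact (by fun_prop : Continuous _).intervalIntegrable _ _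

lemma TI_of_SI {μ : ℝ} (x : ℝ) (h : Real.sin (μ*π) ≠ 0) : (SI μ x * Real.cos (μ*π) - SI (-μ) x) / Real.sin (μ*π) = TI μ x := by
  unfold SI TI
  rw [AI_neg, show -μ*π = -(μ*π) by ring, Real.sin_neg]
  have := Real.pi_pos
  field_simp
  ring

lemma AI_cont_order (δ x : ℝ) : Continuous (fun ν => AI δ ν x) := by
  unfold AI
  apply intervalIntegral.continuous_parametric_intervalIntegral_of_continuous'
  simp only [Function.uncurry_def]
  fun_prop

lemma BI_cont_order {x : ℝ} (hx : 0 < x) : Continuous (fun ν => BI ν x) := by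
  rw [continuous_iff_continuousAt]
  intro ν
  unfold BI
  refine MeasureTheory.continuousAt_of_dominated (bound := fun t => Real.exp ((1+(|ν|+1))^2/x) * Real.exp (-t)) ?_ ?_ ?_ ?_
  · refine Eventually.of_forall fun m => (by fun_prop : Continuous _).aestronglyMeasurable
  · filter_upwards [Metric.ball_mem_nhds ν one_pos] with m hm
    refine (MeasureTheory.ae_restrict_iff' measurableSet_Ioi).2 (Eventually.of_forall fun t ht => ?_)
    rw [Real.norm_eq_abs, abs_of_pos (Real.exp_pos _)]
    refine BI_bound hx le_rfl ?_ (le_of_lt ht)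
    rw [Metric.mem_ball, Real.dist_eq] at hm
    have := abs_sub_abs_le_abs_sub m ν
    linarith
  · exact exp_neg_intOn.const_mul _
  · exact Eventually.of_forall fun t => by fun_prop

lemma TI_cont_order {x : ℝ} (hx : 0 < x) : Continuous (fun ν => TI ν x) := by
  unfold TI
  have h1 := AI_cont_order (-(π/2)) x
  have h2 := BI_cont_order hx
  have h3 : Continuous (fun ν => BI (-ν) x) := h2.comp continuous_neg
  fun_prop

lemma nonint_neBot (ν : ℝ) : (𝓝[{μ : ℝ | ∀ n : ℤ, μ ≠ (n : ℝ)}] ν).NeBot := by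
  have h : Dense {μ : ℝ | ∀ n : ℤ, μ ≠ (n : ℝ)} := by
    refine Dense.mono ?_ dense_irrational
    intro μ hμ n hn
    exact (irrational_iff_ne_rational μ).1 hμ n 1 (by norm_num) (by simpa using hn)
  exact mem_closure_iff_nhdsWithin_neBot.1 (h ν)

lemma TI_eq_Y (ν : ℝ) {x : ℝ} (hx : 0 < x) : besselY ν x = TI ν x := by
  unfold besselY
  haveI := nonint_neBot ν
  apply Tendsto.limUnder_eq
  have h := ((TI_cont_order hx).tendsto ν).mono_left (nhdsWithin_le_nhds (s := {μ : ℝ | ∀ n : ℤ, μ ≠ (n : ℝ)}))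
  refine h.congr' ?_
  filter_upwards [self_mem_nhdsWithin] with μ hμ
  rw [SI_eq_J _ hx, SI_eq_J _ hx, TI_of_SI]
  intro h0
  rw [Real.sin_eq_zero_iff] at h0
  obtain ⟨n, hn⟩ := h0
  exact hμ n (mul_right_cancel₀ Real.pi_ne_zero hn).symm

open Real Filter Topology Set

lemma osc_bound {k k' : ℝ → ℝ} {a b K0 K1 x η : ℝ} (hab : a ≤ b) (hx : 0 < x)
    (hk : ContinuousOn k (Icc a b)) (hd : ∀ s ∈ Ioo a b, HasDerivAt k (k' s) s) (hm : Measurable k')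
    (h0 : ∀ s ∈ Icc a b, |k s| ≤ K0) (h1 : ∀ s ∈ Ioc a b, |k' s| ≤ K1) :
    |∫ s in a..b, k s * (Real.sin s * Real.cos (x * Real.cos s + η))| ≤ (2*K0 + (b-a)*K1)/x := by
  set v : ℝ → ℝ := fun s => -(Real.sin (x * Real.cos s + η))/x with hv
  have hvd : ∀ s, HasDerivAt v (Real.sin s * Real.cos (x * Real.cos s + η)) s := by
    intro s
    have : HasDerivAt (fun s : ℝ => x * Real.cos s + η) (x * (-Real.sin s)) s := ((Real.hasDerivAt_cos s).const_mul x).add_const η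
    refine ((this.sin.neg).div_const x).congr_deriv ?_
    field_simp
  have hvb : ∀ s, |v s| ≤ 1/x := by
    intro s
    rw [hv]; simp only
    rw [abs_div, abs_neg, abs_of_pos hx]
    exact div_le_div_of_nonneg_right (Real.abs_sin_le_one _) hx.le
  have hkint : IntervalIntegrable k' MeasureTheory.volume a b := by
    rw [intervalIntegrable_iff_integrableOn_Ioc_of_le hab]
    refine MeasureTheory.Integrable.mono' (g := fun _ => K1) (by simp) hm.aestronglyMeasurable ?_
    exact (MeasureTheory.ae_restrict_iff' measurableSet_Ioc).2 (Eventually.of_forall h1)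
  have key := intervalIntegral.integral_mul_deriv_eq_deriv_mul_of_hasDerivAt (u := k) (v := v) (u' := k')
    (v' := fun s => Real.sin s * Real.cos (x * Real.cos s + η)) (a := a) (b := b)
    (by rwa [uIcc_of_le hab]) (fun s _ => (hvd s).continuousAt.continuousWithinAt)
    (by rwa [min_eq_left hab, max_eq_right hab]) (fun s _ => hvd s) hkint
    ((by fun_prop : Continuous _).intervalIntegrable _ _)
  rw [key]
  have e1 : |k b * v b| ≤ K0 * (1/x) := by
    rw [abs_mul]
    exact mul_le_mul (h0 b ⟨hab, le_rfl⟩) (hvb b) (abs_nonneg _) ((abs_nonneg _).trans (h0 b ⟨hab, le_rfl⟩))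
  have e2 : |k a * v a| ≤ K0 * (1/x) := by
    rw [abs_mul]
    exact mul_le_mul (h0 a ⟨le_rfl, hab⟩) (hvb a) (abs_nonneg _) ((abs_nonneg _).trans (h0 a ⟨le_rfl, hab⟩))
  have e3 : |∫ s in a..b, k' s * v s| ≤ (K1 * (1/x)) * (b-a) := by
    have := intervalIntegral.norm_integral_le_of_norm_le_const (a := a) (b := b) (C := K1 * (1/x)) (f := fun s => k' s * v s) ?_
    · rwa [Real.norm_eq_abs, abs_of_nonneg (sub_nonneg.2 hab)] at this
    · intro s hs
      rw [uIoc_of_le hab] at hs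
      rw [Real.norm_eq_abs, abs_mul]
      exact mul_le_mul (h1 s hs) (hvb s) (abs_nonneg _) ((abs_nonneg _).trans (h1 s hs))
  have t := abs_sub (k b * v b - k a * v a) (∫ s in a..b, k' s * v s)
  have t2 := abs_sub (k b * v b) (k a * v a)
  have : (2*K0 + (b-a)*K1)/x = K0 * (1/x) + K0*(1/x) + (K1 * (1/x)) * (b-a) := by field_simp; ring
  rw [this]
  linarith

lemma osc_reg (ν : ℝ) : ∃ C : ℝ, ∀ x η : ℝ, 0 < x →
    |∫ s in (0:ℝ)..(π/2), (Real.cos (ν*s) - 1) * Real.cos (x * Real.cos s + η)| ≤ C / x := by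
  have hpi := Real.pi_pos
  set k : ℝ → ℝ := fun s => (Real.cos (ν*s) - 1) / Real.sin s with hk
  set k' : ℝ → ℝ := fun s => ((-Real.sin (ν*s) * ν) * Real.sin s - (Real.cos (ν*s) - 1) * Real.cos s) / Real.sin s ^2 with hk'
  have hsin : ∀ s ∈ Ioc 0 (π/2), 2/π*s ≤ Real.sin s := fun s hs => Real.mul_le_sin hs.1.le hs.2
  have hsp : ∀ s ∈ Ioc 0 (π/2), 0 < Real.sin s := fun s hs => lt_of_lt_of_le (by have := hs.1; positivity) (hsin s hs)
  have hcos : ∀ s, |Real.cos (ν*s) - 1| ≤ ν^2*s^2/2 := by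
    intro s
    have h1 := Real.one_sub_sq_div_two_le_cos (x := ν*s)
    have h2 := Real.cos_le_one (ν*s)
    rw [abs_le]; constructor <;> nlinarith
  have hkb : ∀ s ∈ Ioc 0 (π/2), |k s| ≤ ν^2*π/4 * s := by
    intro s hs
    have hs0 := hs.1
    rw [hk]; simp only
    rw [abs_div, abs_of_pos (hsp s hs), div_le_iff₀ (hsp s hs)]
    refine (hcos s).trans ?_
    calc ν^2*s^2/2 = ν^2*π/4 * s * (2/π*s) := by field_simp; ring
      _ ≤ _ := mul_le_mul_of_nonneg_left (hsin s hs) (by positivity)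
  have hk0 : k 0 = 0 := by simp [hk]
  have hderiv : ∀ s ∈ Ioc 0 (π/2), HasDerivAt k (k' s) s := by
    intro s hs
    have h1 : HasDerivAt (fun s : ℝ => Real.cos (ν*s) - 1) (-Real.sin (ν*s) * ν) s := by
      have : HasDerivAt (fun s : ℝ => ν*s) ν s := by simpa using (hasDerivAt_id s).const_mul ν
      exact this.cos.sub_const 1
    exact h1.div (Real.hasDerivAt_sin s) (hsp s hs).ne'
  refine ⟨2*(ν^2*π/4*(π/2)) + (π/2-0)*(3/8*π^2*ν^2), fun x η hx => ?_⟩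
  have key := osc_bound (k := k) (k' := k') (a := 0) (b := π/2) (K0 := ν^2*π/4*(π/2)) (K1 := 3/8*π^2*ν^2) (x := x) (η := η)
    (by positivity) hx ?_ (fun s hs => hderiv s ⟨hs.1, hs.2.le⟩) (by rw [hk']; fun_prop) ?_ ?_
  · convert key using 2
    apply intervalIntegral.integral_congr_ae
    refine Eventually.of_forall fun s hs => ?_
    rw [uIoc_of_le (by positivity)] at hs
    have := hsp s hs
    rw [hk]; simp only
    field_simp
  · intro s hs
    rcases eq_or_lt_of_le hs.1 with h | h
    · subst h
      have : ContinuousWithinAt k (Ici 0) 0 := by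
        rw [ContinuousWithinAt, hk0]
        have hl : Tendsto (fun s : ℝ => ν^2*π/4*s) (𝓝[Ici 0] 0) (𝓝 0) := by
          have : Tendsto (fun s : ℝ => ν^2*π/4*s) (𝓝 0) (𝓝 (ν^2*π/4*0)) := (by fun_prop : Continuous (fun s : ℝ => ν^2*π/4*s)).tendsto 0
          rw [mul_zero] at this
          exact this.mono_left nhdsWithin_le_nhds
        refine squeeze_zero_norm' ?_ hl
        filter_upwards [self_mem_nhdsWithin, mem_nhdsWithin_of_mem_nhds (Iio_mem_nhds (by positivity : (0:ℝ) < π/2))] with t ht ht2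
        rcases eq_or_lt_of_le (show (0:ℝ) ≤ t from ht) with h | h
        · subst h; simp [hk0]
        · exact hkb t ⟨h, le_of_lt ht2⟩
      exact this.mono fun t ht => ht.1
    · exact (hderiv s ⟨h, hs.2⟩).continuousAt.continuousWithinAt
  · intro s hs
    rcases eq_or_lt_of_le hs.1 with h | h
    · subst h; rw [hk0, abs_zero]; positivity
    · refine (hkb s ⟨h, hs.2⟩).trans ?_
      exact mul_le_mul_of_nonneg_left hs.2 (by positivity)
  · intro s hs
    have hs0 := hs.1
    have hp := hsp s hs
    rw [hk']; simp only
    rw [abs_div, abs_of_pos (by positivity : 0 < Real.sin s ^2), div_le_iff₀ (by positivity)]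
    have b1 : |(-Real.sin (ν*s) * ν) * Real.sin s| ≤ ν^2*s^2 := by
      rw [abs_mul, abs_mul, abs_neg, abs_of_pos hp]
      have i1 : |Real.sin (ν*s)| ≤ |ν| * s := by
        have := Real.abs_sin_le_abs (x := ν*s)
        rwa [abs_mul, abs_of_pos hs0] at this
      have i2 : Real.sin s ≤ s := Real.sin_le hs0.le
      calc |Real.sin (ν*s)| * |ν| * Real.sin s ≤ (|ν| * s) * |ν| * s := by gcongr
        _ = |ν| ^ 2 * s ^ 2 := by ring
        _ = _ := by rw [sq_abs]
    have b2 : |(Real.cos (ν*s) - 1) * Real.cos s| ≤ ν^2*s^2/2 := by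
      rw [abs_mul]
      calc _ ≤ (ν^2*s^2/2) * 1 := mul_le_mul (hcos s) (Real.abs_cos_le_one _) (abs_nonneg _) (by positivity)
        _ = _ := mul_one _
    have b3 := abs_sub ((-Real.sin (ν*s) * ν) * Real.sin s) ((Real.cos (ν*s) - 1) * Real.cos s)
    have b4 : (2/π*s)^2 ≤ Real.sin s ^2 := by
      have := hsin s hs
      gcongr
    calc _ ≤ ν^2*s^2 + ν^2*s^2/2 := by linarith
      _ = 3/8*π^2*ν^2 * (2/π*s)^2 := by field_simp; ring
      _ ≤ _ := mul_le_mul_of_nonneg_left b4 (by positivity)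

lemma osc_zero (η : ℝ) : Tendsto (fun x : ℝ => ∫ s in (0:ℝ)..(π/2), Real.cos (x * Real.cos s + η)) atTop (𝓝 0) := by
  have hpi := Real.pi_pos
  rw [Metric.tendsto_atTop]
  intro e he
  set ε := min (e/2) 1 with hε
  have hε0 : 0 < ε := by positivity
  have hε1 : ε ≤ 1 := min_le_right _ _
  have hεe : ε ≤ e/2 := min_le_left _ _
  have hεp : ε ≤ π/2 := by have := Real.pi_gt_three; linarith
  have hsε : 0 < Real.sin ε := Real.sin_pos_of_pos_of_lt_pi hε0 (by linarith)
  have hsge : ∀ s ∈ Icc ε (π/2), Real.sin ε ≤ Real.sin s := fun s hs =>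
    Real.sin_le_sin_of_le_of_le_pi_div_two (by linarith) hs.2 hs.1
  set D := 2*(1/Real.sin ε) + (π/2-ε)*(1/Real.sin ε^2) with hD
  have hD0 : 0 ≤ D := by
    have : 0 ≤ π/2-ε := by linarith
    positivity
  have hb : ∀ x, 0 < x → |∫ s in ε..(π/2), Real.cos (x * Real.cos s + η)| ≤ D/x := by
    intro x hx
    have key := osc_bound (k := fun s => (Real.sin s)⁻¹) (k' := fun s => -Real.cos s / Real.sin s^2) (a := ε) (b := π/2) (K0 := 1/Real.sin ε)
      (K1 := 1/Real.sin ε^2) (x := x) (η := η) hεp hx ?_ ?_ (by fun_prop) ?_ ?_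
    · convert key using 2
      apply intervalIntegral.integral_congr
      intro s hs
      rw [uIcc_of_le hεp] at hs
      have := lt_of_lt_of_le hsε (hsge s hs)
      simp only
      field_simp
    · intro s hs
      have := lt_of_lt_of_le hsε (hsge s hs)
      exact (Real.continuous_sin.continuousAt.inv₀ this.ne').continuousWithinAt
    · intro s hs
      have := lt_of_lt_of_le hsε (hsge s ⟨hs.1.le, hs.2.le⟩)
      exact (Real.hasDerivAt_sin s).inv this.ne'
    · intro s hs
      have h2 := hsge s hs
      have := lt_of_lt_of_le hsε h2
      rw [abs_of_pos (by positivity), ← one_div]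
      exact one_div_le_one_div_of_le hsε h2
    · intro s hs
      have h2 := hsge s ⟨hs.1.le, hs.2⟩
      have := lt_of_lt_of_le hsε h2
      rw [abs_div, abs_neg, abs_of_pos (by positivity : 0 < Real.sin s^2)]
      have h3 := Real.abs_cos_le_one s
      gcongr
  refine ⟨2*D/e + 1, fun x hx => ?_⟩
  have hx0 : 0 < x := lt_of_lt_of_le (by positivity) hx
  have hs1 : |∫ s in (0:ℝ)..ε, Real.cos (x * Real.cos s + η)| ≤ 1 * (ε - 0) := by
    have := intervalIntegral.norm_integral_le_of_norm_le_const (a := 0) (b := ε) (C := 1) (f := fun s => Real.cos (x * Real.cos s + η))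
      (fun θ _ => by rw [Real.norm_eq_abs]; exact Real.abs_cos_le_one _)
    rwa [Real.norm_eq_abs, abs_of_pos (by linarith : 0 < ε - 0)] at this
  have hadd := intervalIntegral.integral_add_adjacent_intervals (μ := MeasureTheory.volume) (a := 0) (b := ε) (c := π/2) (f := fun s => Real.cos (x * Real.cos s + η))
    ((by fun_prop : Continuous _).intervalIntegrable _ _) ((by fun_prop : Continuous _).intervalIntegrable _ _)
  rw [Real.dist_eq, sub_zero, ← hadd]
  have h3 := hb x hx0
  have h4 : D/x < e/2 := by
    rw [div_lt_iff₀ hx0]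
    have : 2*D/e < x := by linarith
    rw [div_lt_iff₀ he] at this
    linarith
  have := abs_add_le (∫ s in (0:ℝ)..ε, Real.cos (x * Real.cos s + η)) (∫ s in ε..(π/2), Real.cos (x * Real.cos s + η))
  linarith

lemma AI_half (δ ν x : ℝ) : AI δ ν x = 2 * ∫ s in (0:ℝ)..(π/2), Real.cos (ν*s) * Real.cos (x * Real.cos s + (δ - ν*π/2)) := by
  unfold AI
  set F : ℝ → ℝ := fun s => Real.cos (x * Real.cos s + ν * s + (δ - ν*π/2)) with hF
  have hFc : Continuous F := by rw [hF]; fun_prop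
  have h := intervalIntegral.integral_comp_sub_left (a := 0) (b := π) F (π/2)
  have e1 : ∀ θ, Real.cos (x * Real.sin θ - ν * θ + δ) = F (π/2 - θ) := by
    intro θ
    rw [hF]; simp only
    rw [Real.cos_pi_div_two_sub]
    congr 1; ring
  simp_rw [e1]
  rw [h, sub_zero, show π/2 - π = -(π/2) by ring,
    ← intervalIntegral.integral_add_adjacent_intervals (b := 0) (hFc.intervalIntegrable _ _) (hFc.intervalIntegrable _ _)]
  have h2 := intervalIntegral.integral_comp_neg (a := 0) (b := π/2) F
  rw [neg_zero] at h2
  have hFn : Continuous fun a => F (-a) := hFc.comp continuous_neg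
  rw [← h2, ← intervalIntegral.integral_add (hFn.intervalIntegrable _ _) (hFc.intervalIntegrable _ _), ← intervalIntegral.integral_const_mul]
  congr 1
  ext s
  rw [hF]; simp only
  rw [Real.cos_neg, show x * Real.cos s + ν * -s + (δ - ν*π/2) = (x * Real.cos s + (δ - ν*π/2)) - ν*s by ring,
    show x * Real.cos s + ν * s + (δ - ν*π/2) = (x * Real.cos s + (δ - ν*π/2)) + ν*s by ring, Real.cos_add, Real.cos_sub]
  ring

noncomputable def Q1 (x : ℝ) : ℝ := ∫ s in (0:ℝ)..(π/2), Real.cos (x * Real.cos s)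
noncomputable def Q2 (x : ℝ) : ℝ := ∫ s in (0:ℝ)..(π/2), Real.sin (x * Real.cos s)

lemma Q1_lim : Tendsto Q1 atTop (𝓝 0) := by
  refine (osc_zero 0).congr fun x => ?_
  simp [Q1]
lemma Q2_lim : Tendsto Q2 atTop (𝓝 0) := by
  refine (osc_zero (-(π/2))).congr fun x => ?_
  unfold Q2
  congr 1; ext s
  rw [← sub_eq_add_neg, Real.cos_sub_pi_div_two]

lemma AI_asymp (δ ν : ℝ) : ∃ C : ℝ, ∀ x, 0 < x →
    |AI δ ν x - 2 * (Real.cos (δ - ν*π/2) * Q1 x - Real.sin (δ - ν*π/2) * Q2 x)| ≤ C / x := by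
  obtain ⟨C, hC⟩ := osc_reg ν
  refine ⟨2*C, fun x hx => ?_⟩
  have h := hC x (δ - ν*π/2) hx
  have e : AI δ ν x - 2 * (Real.cos (δ - ν*π/2) * Q1 x - Real.sin (δ - ν*π/2) * Q2 x) =
      2 * ∫ s in (0:ℝ)..(π/2), (Real.cos (ν*s) - 1) * Real.cos (x * Real.cos s + (δ - ν*π/2)) := by
    rw [AI_half, ← mul_sub]
    congr 1
    unfold Q1 Q2
    rw [← intervalIntegral.integral_const_mul, ← intervalIntegral.integral_const_mul, ← intervalIntegral.integral_sub, ← intervalIntegral.integral_sub]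
    · congr 1
      ext s
      rw [Real.cos_add]; ring
    all_goals exact (by fun_prop : Continuous _).intervalIntegrable _ _
  rw [e, abs_mul, abs_two]
  calc _ ≤ 2 * (C/x) := by linarith
    _ = _ := by ring

open Real Filter Topology Set

noncomputable def aF (ν x : ℝ) : ℝ := 2/π * (Real.cos (ν*π/2) * Q1 x + Real.sin (ν*π/2) * Q2 x)
noncomputable def bF (ν x : ℝ) : ℝ := 2/π * (-Real.sin (ν*π/2) * Q1 x + Real.cos (ν*π/2) * Q2 x)

lemma aF_lim (ν : ℝ) : Tendsto (aF ν) atTop (𝓝 0) := by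
  have := ((Q1_lim.const_mul (Real.cos (ν*π/2))).add (Q2_lim.const_mul (Real.sin (ν*π/2)))).const_mul (2/π)
  simp only [mul_zero, add_zero] at this
  exact this
lemma bF_lim (ν : ℝ) : Tendsto (bF ν) atTop (𝓝 0) := by
  have := ((Q1_lim.const_mul (-Real.sin (ν*π/2))).add (Q2_lim.const_mul (Real.cos (ν*π/2)))).const_mul (2/π)
  simp only [mul_zero, add_zero] at this
  exact this

lemma BI_bigO (ν : ℝ) : (fun x => BI ν x) =O[atTop] (fun x : ℝ => x⁻¹) := by
  refine Asymptotics.IsBigO.of_bound 2 ?_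
  filter_upwards [eventually_ge_atTop (2*|ν| + 1)] with x hx
  have h0 := abs_nonneg ν
  have h1 := neg_abs_le ν
  have hx0 : 0 < x := by linarith
  rw [Real.norm_eq_abs, Real.norm_eq_abs, abs_of_nonneg (BI_nonneg _ _), abs_of_pos (by positivity)]
  refine (BI_le hx0 (by linarith)).trans ?_
  rw [div_le_iff₀ (by linarith)]
  have : 2 * x⁻¹ * (x/2) = 1 := by field_simp
  rw [← this]
  exact mul_le_mul_of_nonneg_left (by linarith) (by positivity)

lemma AI_bigO (δ ν : ℝ) : (fun x => AI δ ν x - 2 * (Real.cos (δ - ν*π/2) * Q1 x - Real.sin (δ - ν*π/2) * Q2 x)) =O[atTop] (fun x : ℝ => x⁻¹) := by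
  obtain ⟨C, hC⟩ := AI_asymp δ ν
  refine Asymptotics.IsBigO.of_bound C ?_
  filter_upwards [eventually_gt_atTop 0] with x hx
  rw [Real.norm_eq_abs, Real.norm_eq_abs, abs_of_pos (by positivity : 0 < x⁻¹)]
  exact hC x hx

lemma SI_bigO (ν : ℝ) : (fun x => SI ν x - aF ν x) =O[atTop] (fun x : ℝ => x⁻¹) := by
  have h := (((AI_bigO 0 ν).sub ((BI_bigO ν).const_mul_left (Real.sin (ν*π)))).const_mul_left (1/π))
  refine h.congr_left fun x => ?_
  unfold SI aF
  rw [zero_sub, Real.cos_neg, Real.sin_neg]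
  ring

lemma TI_bigO (ν : ℝ) : (fun x => TI ν x - bF ν x) =O[atTop] (fun x : ℝ => x⁻¹) := by
  have h := ((((AI_bigO (-(π/2)) ν).sub (BI_bigO (-ν))).sub ((BI_bigO ν).const_mul_left (Real.cos (ν*π)))).const_mul_left (1/π))
  refine h.congr_left fun x => ?_
  unfold TI bF
  rw [show -(π/2) - ν*π/2 = -(ν*π/2 + π/2) by ring, Real.cos_neg, Real.sin_neg, Real.cos_add_pi_div_two, Real.sin_add_pi_div_two]
  ring

lemma inv_lim : Tendsto (fun x : ℝ => x⁻¹) atTop (𝓝 0) := tendsto_inv_atTop_zero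

lemma SI_lim_top (ν : ℝ) : Tendsto (SI ν) atTop (𝓝 0) := by
  have h := ((SI_bigO ν).trans_tendsto inv_lim).add (aF_lim ν)
  simpa using h
lemma TI_lim_top (ν : ℝ) : Tendsto (TI ν) atTop (𝓝 0) := by
  have h := ((TI_bigO ν).trans_tendsto inv_lim).add (bF_lim ν)
  simpa using h

lemma prod_asymp {S T a b : ℝ → ℝ} (hS : (fun x => S x - a x) =O[atTop] (fun x : ℝ => x⁻¹))
    (hT : (fun x => T x - b x) =O[atTop] (fun x : ℝ => x⁻¹)) (hS0 : Tendsto S atTop (𝓝 0)) (hb : Tendsto b atTop (𝓝 0)) :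
    Tendsto (fun x => x * (S x * T x - a x * b x)) atTop (𝓝 0) := by
  have hone : ∀ g : ℝ → ℝ, g =O[atTop] (fun x : ℝ => x⁻¹) → (fun x => x * g x) =O[atTop] (fun _ : ℝ => (1:ℝ)) := by
    intro g hg
    refine ((Asymptotics.isBigO_refl (fun x : ℝ => x) atTop).mul hg).congr' EventuallyEq.rfl ?_
    filter_upwards [eventually_gt_atTop 0] with x hx
    field_simp
  have h1 : Tendsto (fun x => S x * (x * (T x - b x))) atTop (𝓝 0) := by
    have := ((Asymptotics.isLittleO_one_iff ℝ).2 hS0).mul_isBigO (hone _ hT)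
    simpa [Asymptotics.isLittleO_one_iff] using this
  have h2 : Tendsto (fun x => b x * (x * (S x - a x))) atTop (𝓝 0) := by
    have := ((Asymptotics.isLittleO_one_iff ℝ).2 hb).mul_isBigO (hone _ hS)
    simpa [Asymptotics.isLittleO_one_iff] using this
  have := h1.add h2
  rw [add_zero] at this
  refine this.congr fun x => by ring

lemma aF_succ (ν x : ℝ) : aF (ν+1) x = bF ν x := by
  unfold aF bF
  rw [show (ν+1)*π/2 = ν*π/2 + π/2 by ring, Real.cos_add_pi_div_two, Real.sin_add_pi_div_two]
lemma bF_succ (ν x : ℝ) : bF (ν+1) x = - aF ν x := by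
  unfold aF bF
  rw [show (ν+1)*π/2 = ν*π/2 + π/2 by ring, Real.cos_add_pi_div_two, Real.sin_add_pi_div_two]
  ring

/-- The (scaled) Wronskian of `S_ν` and `T_μ`. -/
noncomputable def Wr (ν μ x : ℝ) : ℝ :=
  (ν * SI ν x - x * SI (ν+1) x) * TI μ x - SI ν x * (μ * TI μ x - x * TI (μ+1) x)

lemma Wr_asymp (ν μ : ℝ) : Tendsto (fun x => Wr ν μ x + x * (4/π^2 * (Q1 x^2 + Q2 x^2)) * Real.cos ((ν-μ)*π/2)) atTop (𝓝 0) := by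
  have h1 := prod_asymp (SI_bigO ν) (TI_bigO (μ+1)) (SI_lim_top ν) (bF_lim (μ+1))
  have h2 := prod_asymp (SI_bigO (ν+1)) (TI_bigO μ) (SI_lim_top (ν+1)) (bF_lim μ)
  have h3 := ((SI_lim_top ν).mul (TI_lim_top μ)).const_mul (ν - μ)
  have h := (h1.sub h2).add h3
  rw [mul_zero, mul_zero, sub_zero, add_zero] at h
  refine h.congr fun x => ?_
  rw [aF_succ, bF_succ]
  unfold Wr aF bF
  rw [show (ν-μ)*π/2 = ν*π/2 - μ*π/2 by ring, Real.cos_sub]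
  have := Real.pi_pos
  field_simp
  linear_combination (- 4 * x * (Q1 x^2 + Q2 x^2) + 4 * x * (Q1 x^2 + Q2 x^2)) * Real.sin_sq_add_cos_sq (ν*π/2)

lemma Wr_lim (ν μ ω : ℝ) (hω : ∀ x, 0 < x → Wr μ μ x = ω) : Tendsto (Wr ν μ) atTop (𝓝 (ω * Real.cos ((ν-μ)*π/2))) := by
  have h1 := Wr_asymp ν μ
  have h2 := (Wr_asymp μ μ).mul_const (Real.cos ((ν-μ)*π/2))
  have h := (h1.sub h2).add_const (ω * Real.cos ((ν-μ)*π/2))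
  rw [zero_mul, sub_zero, zero_add] at h
  refine h.congr' ?_
  filter_upwards [eventually_gt_atTop 0] with x hx
  rw [hω x hx, sub_self, zero_mul, zero_div, Real.cos_zero]
  ring

open Real Filter Topology Set

structure Sol (ν : ℝ) (f G : ℝ → ℝ) : Prop where
  d1 : ∀ x, 0 < x → HasDerivAt f (G x / x) x
  d2 : ∀ x, 0 < x → HasDerivAt G ((ν^2/x - x) * f x) x

lemma Cyl.sol {C : ℝ → ℝ → ℝ} (hC : Cyl C) (ν : ℝ) : Sol ν (C ν) (fun x => ν * C ν x - x * C (ν+1) x) := by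
  constructor
  · intro x hx
    refine (hC ν x hx).1.congr_deriv ?_
    field_simp
  · intro x hx
    have h := (hC (ν+1) x hx).2
    rw [add_sub_cancel_right] at h
    refine (((hC ν x hx).1.const_mul ν).sub ((hasDerivAt_id x).mul h)).congr_deriv ?_
    simp only [id]
    field_simp
    ring

lemma Sol.neg {ν : ℝ} {f G : ℝ → ℝ} (h : Sol ν f G) : Sol ν (fun x => - f x) (fun x => - G x) := by
  constructor
  · intro x hx
    exact (h.d1 x hx).neg.congr_deriv (by ring)
  · intro x hx
    exact (h.d2 x hx).neg.congr_deriv (by ring)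

lemma Sol.cont {ν : ℝ} {f G : ℝ → ℝ} (h : Sol ν f G) {x : ℝ} (hx : 0 < x) : ContinuousAt f x := (h.d1 x hx).continuousAt

lemma Sol.wr {ν μ : ℝ} {f F g G : ℝ → ℝ} (hf : Sol ν f F) (hg : Sol μ g G) {x : ℝ} (hx : 0 < x) :
    HasDerivAt (fun x => F x * g x - f x * G x) ((ν^2 - μ^2)/x * (f x * g x)) x := by
  refine (((hf.d2 x hx).mul (hg.d1 x hx)).sub ((hf.d1 x hx).mul (hg.d2 x hx))).congr_deriv ?_
  field_simp
  ring

/-- sign is constant on an interval without zeros -/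
lemma sign_const {f : ℝ → ℝ} {s : Set ℝ} (hs : s.OrdConnected) (hf : ContinuousOn f s) (hz : ∀ x ∈ s, f x ≠ 0) :
    (∀ x ∈ s, 0 < f x) ∨ (∀ x ∈ s, f x < 0) := by
  by_contra hc
  push Not at hc
  obtain ⟨⟨x, hx, hx1⟩, ⟨y, hy, hy1⟩⟩ := hc
  have hp : IsPreconnected s := isPreconnected_iff_ordConnected.2 hs
  obtain ⟨c, hc, hc0⟩ := hp.intermediate_value hx hy hf ⟨hx1, hy1⟩
  exact hz c hc hc0

lemma deriv_nonneg_right {f : ℝ → ℝ} {a b d : ℝ} (hab : a < b) (hd : HasDerivAt f d a) (h0 : f a = 0)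
    (hp : ∀ x ∈ Ioo a b, 0 ≤ f x) : 0 ≤ d := by
  have h := hd.hasDerivWithinAt (s := Ioi a)
  rw [hasDerivWithinAt_iff_tendsto_slope' (by simp)] at h
  refine ge_of_tendsto h ?_
  filter_upwards [Ioo_mem_nhdsGT hab] with y hy
  rw [slope_def_field, h0, sub_zero]
  exact div_nonneg (hp y hy) (by linarith [hy.1])

lemma deriv_nonpos_left {f : ℝ → ℝ} {a b d : ℝ} (hab : a < b) (hd : HasDerivAt f d b) (h0 : f b = 0)
    (hp : ∀ x ∈ Ioo a b, 0 ≤ f x) : d ≤ 0 := by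
  have h := hd.hasDerivWithinAt (s := Iio b)
  rw [hasDerivWithinAt_iff_tendsto_slope' (by simp)] at h
  refine le_of_tendsto h ?_
  filter_upwards [Ioo_mem_nhdsLT hab] with y hy
  rw [slope_def_field, h0, sub_zero]
  exact div_nonpos_of_nonneg_of_nonpos (hp y hy) (by linarith [hy.2])

lemma Sol.G_nonneg {ν : ℝ} {f G : ℝ → ℝ} (h : Sol ν f G) {a b : ℝ} (ha : 0 < a) (hab : a < b) (h0 : f a = 0)
    (hp : ∀ x ∈ Ioo a b, 0 ≤ f x) : 0 ≤ G a := by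
  have := deriv_nonneg_right hab (h.d1 a ha) h0 hp
  have h2 := mul_nonneg this ha.le
  rwa [div_mul_cancel₀ _ ha.ne'] at h2

lemma Sol.G_nonpos {ν : ℝ} {f G : ℝ → ℝ} (h : Sol ν f G) {a b : ℝ} (hb : 0 < b) (hab : a < b) (h0 : f b = 0)
    (hp : ∀ x ∈ Ioo a b, 0 ≤ f x) : G b ≤ 0 := by
  have := deriv_nonpos_left hab (h.d1 b hb) h0 hp
  have h2 := mul_nonpos_of_nonpos_of_nonneg this hb.le
  rwa [div_mul_cancel₀ _ hb.ne'] at h2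

lemma nonneg_closure {f : ℝ → ℝ} {a b : ℝ} (hab : a < b) (hc : ∀ x ∈ Icc a b, ContinuousAt f x) (hp : ∀ x ∈ Ioo a b, 0 < f x) :
    ∀ x ∈ Icc a b, 0 ≤ f x := by
  intro x hx
  have hx' : x ∈ closure (Ioo a b) := by rwa [closure_Ioo hab.ne]
  have := mem_closure_iff_nhdsWithin_neBot.1 hx'
  have h := (hc x hx).tendsto.mono_left (nhdsWithin_le_nhds (s := Ioo a b))
  refine ge_of_tendsto h ?_
  filter_upwards [self_mem_nhdsWithin] with y hy using (hp y hy).le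

lemma sturm_aux {α β : ℝ} {f F g G : ℝ → ℝ} (hf : Sol α f F) (hg : Sol β g G) (hαβ : β^2 < α^2) {a b : ℝ} (ha : 0 < a)
    (hab : a < b) (h0 : f a = 0) (h1 : f b = 0) (hfp : ∀ x ∈ Ioo a b, 0 < f x) (hgp : ∀ x ∈ Ioo a b, 0 < g x) : False := by
  have hmono : StrictMonoOn (fun x => F x * g x - f x * G x) (Icc a b) := by
    apply strictMonoOn_of_deriv_pos (convex_Icc a b)
    · exact fun x hx => (hf.wr hg (lt_of_lt_of_le ha hx.1)).continuousAt.continuousWithinAt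
    · rw [interior_Icc]
      intro x hx
      have hx0 := ha.trans hx.1
      rw [(hf.wr hg hx0).deriv]
      have := hfp x hx
      have := hgp x hx
      have : 0 < α^2 - β^2 := by linarith
      positivity
  have hgn := nonneg_closure hab (fun x hx => hg.cont (lt_of_lt_of_le ha hx.1)) hgp
  have hw := hmono ⟨le_rfl, hab.le⟩ ⟨hab.le, le_rfl⟩ hab
  simp only [h0, h1, zero_mul, sub_zero] at hw
  have w1 := mul_nonneg (hf.G_nonneg ha hab h0 fun x hx => (hfp x hx).le) (hgn a ⟨le_rfl, hab.le⟩)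
  have w2 := mul_nonpos_of_nonpos_of_nonneg (hf.G_nonpos (ha.trans hab) hab h1 fun x hx => (hfp x hx).le) (hgn b ⟨hab.le, le_rfl⟩)
  linarith

lemma sturm {α β : ℝ} {f F g G : ℝ → ℝ} (hf : Sol α f F) (hg : Sol β g G) (hαβ : β^2 < α^2) {a b : ℝ} (ha : 0 < a)
    (hab : a < b) (h0 : f a = 0) (h1 : f b = 0) (hfz : ∀ x ∈ Ioo a b, f x ≠ 0) : ∃ x ∈ Ioo a b, g x = 0 := by
  by_contra hc
  push Not at hc
  have cf : ContinuousOn f (Ioo a b) := fun x hx => (hf.cont (ha.trans hx.1)).continuousWithinAt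
  have cg : ContinuousOn g (Ioo a b) := fun x hx => (hg.cont (ha.trans hx.1)).continuousWithinAt
  rcases sign_const ordConnected_Ioo cf hfz with sf | sf <;> rcases sign_const ordConnected_Ioo cg hc with sg | sg
  · exact sturm_aux hf hg hαβ ha hab h0 h1 sf sg
  · exact sturm_aux hf hg.neg hαβ ha hab h0 h1 sf (fun x hx => by have := sg x hx; linarith)
  · exact sturm_aux hf.neg hg hαβ ha hab (by simp [h0]) (by simp [h1]) (fun x hx => by have := sf x hx; linarith) sg
  · exact sturm_aux hf.neg hg.neg hαβ ha hab (by simp [h0]) (by simp [h1]) (fun x hx => by have := sf x hx; linarith)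
      (fun x hx => by have := sg x hx; linarith)

lemma osc_aux {ν : ℝ} {f G : ℝ → ℝ} (h : Sol ν f G) {A : ℝ} (hA : |ν| < A) (hp : ∀ x, A ≤ x → 0 < f x) : False := by
  have hA0 : 0 < A := lt_of_le_of_lt (abs_nonneg _) hA
  have hq : ∀ x, A ≤ x → ν^2/x - x < 0 := by
    intro x hx
    have hx0 : 0 < x := by linarith
    rw [sub_neg, div_lt_iff₀ hx0, ← sq_abs]
    nlinarith [abs_nonneg ν]
  have hGanti : AntitoneOn G (Ici A) := by
    apply antitoneOn_of_deriv_nonpos (convex_Ici A)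
    · exact fun x hx => (h.d2 x (lt_of_lt_of_le hA0 hx)).continuousAt.continuousWithinAt
    · rw [interior_Ici]; exact fun x hx => (h.d2 x (hA0.trans hx)).differentiableAt.differentiableWithinAt
    · rw [interior_Ici]; intro x hx
      rw [(h.d2 x (hA0.trans hx)).deriv]
      have hx : A < x := hx
      exact mul_nonpos_of_nonpos_of_nonneg (hq x hx.le).le (hp x hx.le).le
  by_cases hG : ∃ x0, A ≤ x0 ∧ G x0 < 0
  · obtain ⟨x0, hx0, hG0⟩ := hG
    have hx00 : 0 < x0 := by linarith
    have hd : ∀ x, 0 < x → HasDerivAt (fun x => f x - G x0 * Real.log x) (G x / x - G x0 * x⁻¹) x := fun x hx =>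
      (h.d1 x hx).sub ((Real.hasDerivAt_log hx.ne').const_mul _)
    have hanti : AntitoneOn (fun x => f x - G x0 * Real.log x) (Ici x0) := by
      apply antitoneOn_of_deriv_nonpos (convex_Ici x0)
      · exact fun x hx => (hd x (lt_of_lt_of_le hx00 hx)).continuousAt.continuousWithinAt
      · rw [interior_Ici]; exact fun x hx => (hd x (hx00.trans hx)).differentiableAt.differentiableWithinAt
      · rw [interior_Ici]; intro x hx
        have hx : x0 < x := hx
        rw [(hd x (hx00.trans hx)).deriv, div_eq_mul_inv, ← sub_mul]
        have h1 : G x ≤ G x0 := hGanti hx0 (hx0.trans hx.le) hx.le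
        have h2 : 0 < x⁻¹ := inv_pos.2 (hx00.trans hx)
        exact mul_nonpos_of_nonpos_of_nonneg (by linarith) h2.le
    have hlog : Tendsto (fun x => (- G x0) * Real.log x) atTop atTop := Real.tendsto_log_atTop.const_mul_atTop (by linarith)
    obtain ⟨x, hx1, hx2⟩ := ((hlog.eventually_gt_atTop (f x0 - G x0 * Real.log x0)).and (eventually_ge_atTop x0)).exists
    have h3 := hanti (mem_Ici.2 le_rfl) (mem_Ici.2 hx2) hx2
    simp only at h3
    have := hp x (hx0.trans hx2)
    linarith
  · push Not at hG
    have hfm : MonotoneOn f (Ici A) := by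
      apply monotoneOn_of_deriv_nonneg (convex_Ici A)
      · exact fun x hx => (h.d1 x (lt_of_lt_of_le hA0 hx)).continuousAt.continuousWithinAt
      · rw [interior_Ici]; exact fun x hx => (h.d1 x (hA0.trans hx)).differentiableAt.differentiableWithinAt
      · rw [interior_Ici]; intro x hx
        have hx : A < x := hx
        rw [(h.d1 x (hA0.trans hx)).deriv]
        exact div_nonneg (hG x hx.le) (hA0.trans hx).le
    set c := (A - ν^2/A) * f A with hc
    have hc0 : 0 < c := mul_pos (by have := hq A le_rfl; linarith) (hp A le_rfl)
    have hd : ∀ x, 0 < x → HasDerivAt (fun x => G x + c * x) ((ν^2/x - x) * f x + c * 1) x := fun x hx =>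
      (h.d2 x hx).add ((hasDerivAt_id x).const_mul c)
    have hanti : AntitoneOn (fun x => G x + c * x) (Ici A) := by
      apply antitoneOn_of_deriv_nonpos (convex_Ici A)
      · exact fun x hx => (hd x (lt_of_lt_of_le hA0 hx)).continuousAt.continuousWithinAt
      · rw [interior_Ici]; exact fun x hx => (hd x (hA0.trans hx)).differentiableAt.differentiableWithinAt
      · rw [interior_Ici]; intro x hx
        have hx : A < x := hx
        rw [(hd x (hA0.trans hx)).deriv]
        have h1 : f A ≤ f x := hfm (mem_Ici.2 le_rfl) hx.le hx.le
        have h2 : ν^2/x ≤ ν^2/A := div_le_div_of_nonneg_left (sq_nonneg _) hA0 hx.le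
        have h3 : A - ν^2/A ≤ x - ν^2/x := by linarith
        have h4 : c ≤ (x - ν^2/x) * f x := mul_le_mul h3 h1 (hp A le_rfl).le (by have := hq x hx.le; linarith)
        linarith
    have hlin : Tendsto (fun x => c * x) atTop atTop := tendsto_id.const_mul_atTop hc0
    obtain ⟨x, hx1, hx2⟩ := ((hlin.eventually_gt_atTop (G A + c * A)).and (eventually_ge_atTop A)).exists
    have h3 := hanti (mem_Ici.2 le_rfl) (mem_Ici.2 hx2) hx2
    simp only at h3
    have := hG x hx2
    linarith

lemma Sol.unbounded {ν : ℝ} {f G : ℝ → ℝ} (h : Sol ν f G) (A : ℝ) : ∃ x, A < x ∧ f x = 0 := by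
  by_contra hc
  push Not at hc
  set B := max (A+1) (|ν|+1) with hB
  have hB1 : |ν| < B := by have := le_max_right (A+1) (|ν|+1); linarith
  have hB2 : A < B := by have := le_max_left (A+1) (|ν|+1); linarith
  have hB0 : 0 < B := lt_of_le_of_lt (abs_nonneg _) hB1
  rcases sign_const (s := Ici B) ordConnected_Ici (fun x hx => (h.cont (lt_of_lt_of_le hB0 hx)).continuousWithinAt)
    (fun x hx => hc x (lt_of_lt_of_le hB2 hx)) with s | s
  · exact osc_aux h hB1 s
  · exact osc_aux h.neg hB1 (fun x hx => by have := s x hx; linarith)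

structure ZEnum (f : ℝ → ℝ) (z : ℕ → ℝ) : Prop where
  mono : StrictMono z
  pos : ∀ k, 0 < z k
  zero : ∀ k, f (z k) = 0
  first : ∀ x, 0 < x → x < z 0 → f x ≠ 0
  gap : ∀ k, ∀ x ∈ Ioo (z k) (z (k+1)), f x ≠ 0
  top : Tendsto z atTop atTop

lemma ZEnum.all {f : ℝ → ℝ} {z : ℕ → ℝ} (h : ZEnum f z) {x : ℝ} (hx : 0 < x) (hf : f x = 0) : ∃ k, x = z k := by
  have hex : ∃ k, x ≤ z k := (h.top.eventually_ge_atTop x).exists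
  classical
  have h1 := Nat.find_spec hex
  rcases hk : Nat.find hex with _ | m
  · rw [hk] at h1
    rcases eq_or_lt_of_le h1 with h2 | h2
    · exact ⟨0, h2⟩
    · exact absurd hf (h.first x hx h2)
  · rw [hk] at h1
    have h3 : ¬ x ≤ z m := Nat.find_min hex (by omega)
    rcases eq_or_lt_of_le h1 with h2 | h2
    · exact ⟨_, h2⟩
    · exact absurd hf (h.gap m x ⟨not_le.1 h3, h2⟩)

lemma next_zero {ν : ℝ} {f G : ℝ → ℝ} (h : Sol ν f G) (hs : ∀ x, 0 < x → f x = 0 → G x ≠ 0) {x : ℝ} (hx : 0 < x) :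
    ∃ y, x < y ∧ f y = 0 ∧ ∀ t ∈ Ioo x y, f t ≠ 0 := by
  have hiso : ∀ᶠ t in 𝓝[>] x, f t ≠ 0 := by
    by_cases hf : f x = 0
    · have h1 := (h.d1 x hx).eventually_ne (c := 0) (div_ne_zero (hs x hx hf) hx.ne')
      exact h1.filter_mono (nhdsWithin_mono _ fun t ht => ne_of_gt ht)
    · exact ((h.cont hx).eventually_ne hf).filter_mono nhdsWithin_le_nhds
  obtain ⟨u, hu, hu2⟩ := (mem_nhdsGT_iff_exists_Ioo_subset).1 hiso
  set Z : Set ℝ := {y | u ≤ y ∧ f y = 0} with hZ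
  have hZne : Z.Nonempty := by
    obtain ⟨y, hy, hy0⟩ := h.unbounded u
    exact ⟨y, hy.le, hy0⟩
  have hxu : x < u := hu
  have hZb : BddBelow Z := ⟨u, fun y hy => hy.1⟩
  have hZc : IsClosed Z := by
    have : Z = Ici u ∩ f ⁻¹' {0} := by ext y; simp [hZ]
    rw [this]
    apply ContinuousOn.preimage_isClosed_of_isClosed _ isClosed_Ici isClosed_singleton
    exact fun y hy => (h.cont (lt_of_lt_of_le (hx.trans hxu) hy)).continuousWithinAt
  have hm := hZc.csInf_mem hZne hZb
  refine ⟨sInf Z, lt_of_lt_of_le hxu hm.1, hm.2, fun t ht h0 => ?_⟩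
  by_cases htu : t < u
  · exact hu2 ⟨ht.1, htu⟩ h0
  · have := csInf_le hZb (show t ∈ Z from ⟨not_lt.1 htu, h0⟩)
    linarith [ht.2]

lemma exists_ZEnum {ν : ℝ} {f G : ℝ → ℝ} (h : Sol ν f G) (hs : ∀ x, 0 < x → f x = 0 → G x ≠ 0)
    (h0 : ∃ ε > 0, ∀ x, 0 < x → x ≤ ε → f x ≠ 0) : ∃ z, ZEnum f z := by
  obtain ⟨ε, hε, hε0⟩ := h0
  have hn : ∀ x, ∃ y, 0 < x → (x < y ∧ f y = 0 ∧ ∀ t ∈ Ioo x y, f t ≠ 0) := by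
    intro x
    by_cases hx : 0 < x
    · obtain ⟨y, hy⟩ := next_zero h hs hx
      exact ⟨y, fun _ => hy⟩
    · exact ⟨0, fun h => absurd h hx⟩
  choose n hn using hn
  set z : ℕ → ℝ := fun k => n^[k+1] ε with hz
  have hz0 : z 0 = n ε := rfl
  have hzs : ∀ k, z (k+1) = n (z k) := fun k => Function.iterate_succ_apply' n (k+1) ε
  have hpos : ∀ k, 0 < z k := by
    intro k
    induction k with
    | zero => rw [hz0]; exact hε.trans (hn ε hε).1
    | succ k ih => rw [hzs]; exact ih.trans (hn _ ih).1
  have hmono : StrictMono z := strictMono_nat_of_lt_succ fun k => by rw [hzs]; exact (hn _ (hpos k)).1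
  have hzero : ∀ k, f (z k) = 0 := by
    intro k
    cases k with
    | zero => rw [hz0]; exact (hn ε hε).2.1
    | succ k => rw [hzs]; exact (hn _ (hpos k)).2.1
  refine ⟨z, hmono, hpos, hzero, ?_, ?_, ?_⟩
  · intro x hx hx1
    by_cases hxe : x ≤ ε
    · exact hε0 x hx hxe
    · rw [hz0] at hx1
      exact (hn ε hε).2.2 x ⟨not_le.1 hxe, hx1⟩
  · intro k x hx
    rw [hzs] at hx
    exact (hn _ (hpos k)).2.2 x hx
  · rcases tendsto_atTop_of_monotone hmono.monotone with ht | ⟨L, hL⟩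
    · exact ht
    · exfalso
      have hlt : ∀ k, z k < L := fun k => lt_of_lt_of_le (hmono (Nat.lt_succ_self k)) (hmono.monotone.ge_of_tendsto hL (k+1))
      have hL0 : 0 < L := (hpos 0).trans (hlt 0)
      have hfL : f L = 0 := by
        have := (h.cont hL0).tendsto.comp hL
        refine tendsto_nhds_unique this ?_
        simp only [Function.comp_def, hzero]
        exact tendsto_const_nhds
      have h1 := (h.d1 L hL0).eventually_ne (c := 0) (div_ne_zero (hs L hL0 hfL) hL0.ne')
      have h2 : Tendsto z atTop (𝓝[≠] L) := tendsto_nhdsWithin_iff.2 ⟨hL, Eventually.of_forall fun k => (hlt k).ne⟩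
      obtain ⟨k, hk⟩ := (h2.eventually h1).exists
      exact hk (hzero k)

lemma enum_le {g : ℝ → ℝ} {a b : ℕ → ℝ} (ha : ∀ k, 0 < a k) (hb : ZEnum g b) (h0 : b 0 ≤ a 0)
    (hx : ∀ k, ∃ x ∈ Ioo (a k) (a (k+1)), g x = 0) : ∀ k, b k ≤ a k := by
  intro k
  induction k with
  | zero => exact h0
  | succ k ih =>
    obtain ⟨x, hx1, hx2⟩ := hx k
    obtain ⟨m, hm⟩ := hb.all ((ha k).trans hx1.1) hx2
    have h1 : b k < b m := by rw [← hm]; exact lt_of_le_of_lt ih hx1.1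
    have h2 : k + 1 ≤ m := hb.mono.lt_iff_lt.1 h1
    have h3 := hb.mono.monotone h2
    rw [← hm] at h3
    linarith [hx1.2]

lemma enum_le_succ {g : ℝ → ℝ} {a b : ℕ → ℝ} (ha : ∀ k, 0 < a k) (hb : ZEnum g b)
    (hx : ∀ k, ∃ x ∈ Ioo (a k) (a (k+1)), g x = 0) : ∀ k, b k ≤ a (k+1) := by
  refine enum_le (a := fun k => a (k+1)) (fun k => ha _) hb ?_ (fun k => hx (k+1))
  obtain ⟨x, hx1, hx2⟩ := hx 0
  obtain ⟨m, hm⟩ := hb.all ((ha 0).trans hx1.1) hx2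
  have h3 := hb.mono.monotone (Nat.zero_le m)
  rw [← hm] at h3
  exact h3.trans hx1.2.le

lemma sign_step {ν : ℝ} {f G : ℝ → ℝ} (h : Sol ν f G) {a b : ℝ} (ha : 0 < a) (hab : a < b) (h0 : f a = 0) (h1 : f b = 0)
    (hz : ∀ x ∈ Ioo a b, f x ≠ 0) (hG : 0 < G a) : (∀ x ∈ Icc a b, 0 ≤ f x) ∧ G b ≤ 0 := by
  rcases sign_const ordConnected_Ioo (fun x hx => (h.cont (ha.trans hx.1)).continuousWithinAt) hz with s | s
  · exact ⟨nonneg_closure hab (fun x hx => h.cont (lt_of_lt_of_le ha hx.1)) s, h.G_nonpos (ha.trans hab) hab h1 fun x hx => (s x hx).le⟩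
  · exfalso
    have := h.neg.G_nonneg ha hab (by simp [h0]) (fun x hx => by have := s x hx; linarith)
    linarith

lemma sign_G {ν : ℝ} {f G : ℝ → ℝ} (h : Sol ν f G) (hs : ∀ x, 0 < x → f x = 0 → G x ≠ 0) {z : ℕ → ℝ} (hz : ZEnum f z)
    (hp : ∀ x, 0 < x → x < z 0 → 0 < f x) (k : ℕ) : (-1:ℝ)^k * G (z k) < 0 ∧ ∀ x ∈ Icc (z k) (z (k+1)), 0 ≤ (-1:ℝ)^(k+1) * f x := by
  have step : ∀ k, (-1:ℝ)^k * G (z k) < 0 → (-1:ℝ)^(k+1) * G (z (k+1)) < 0 ∧ ∀ x ∈ Icc (z k) (z (k+1)), 0 ≤ (-1:ℝ)^(k+1) * f x := by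
    intro k hk
    have hlt := hz.mono (Nat.lt_succ_self k)
    have hne := hs _ (hz.pos (k+1)) (hz.zero (k+1))
    rcases neg_one_pow_eq_or ℝ k with e | e
    · rw [e] at hk
      rw [pow_succ, e]
      obtain ⟨s1, s2⟩ := sign_step h.neg (hz.pos k) hlt (by simp [hz.zero]) (by simp [hz.zero]) (fun x hx => by simpa using hz.gap k x hx) (by linarith)
      refine ⟨?_, fun x hx => by have := s1 x hx; linarith⟩
      have : 0 < G (z (k+1)) := lt_of_le_of_ne (by linarith) hne.symm
      linarith
    · rw [e] at hk
      rw [pow_succ, e]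
      obtain ⟨s1, s2⟩ := sign_step h (hz.pos k) hlt (by simp [hz.zero]) (by simp [hz.zero]) (fun x hx => by simpa using hz.gap k x hx) (by linarith)
      refine ⟨?_, fun x hx => by have := s1 x hx; linarith⟩
      have : G (z (k+1)) < 0 := lt_of_le_of_ne (by linarith) hne
      linarith
  have hall : ∀ k, (-1:ℝ)^k * G (z k) < 0 := by
    intro k
    induction k with
    | zero =>
      rw [pow_zero, one_mul]
      have h1 := h.G_nonpos (a := 0) (hz.pos 0) (hz.pos 0) (hz.zero 0) (fun x hx => (hp x hx.1 hx.2).le)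
      exact lt_of_le_of_ne h1 (hs _ (hz.pos 0) (hz.zero 0))
    | succ k ih => exact (step k ih).1
  exact ⟨hall k, (step k (hall k)).2⟩

open Real Filter Topology Set

noncomputable def GS (ν x : ℝ) : ℝ := ν * SI ν x - x * SI (ν+1) x
noncomputable def GT (ν x : ℝ) : ℝ := ν * TI ν x - x * TI (ν+1) x

lemma solS (ν : ℝ) : Sol ν (SI ν) (GS ν) := cyl_SI.sol ν
lemma solT (ν : ℝ) : Sol ν (TI ν) (GT ν) := cyl_TI.sol ν

lemma SI_lim0 (ν : ℝ) : Tendsto (fun x => x^(-ν) * SI ν x) (𝓝[>] 0) (𝓝 ((2:ℝ)^(-ν) * (Real.Gamma (ν+1))⁻¹)) := by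
  refine (besselJ_lim ν).congr' ?_
  filter_upwards [self_mem_nhdsWithin] with x hx
  rw [SI_eq_J ν hx]

lemma SI_pos0 {ν : ℝ} (hν : 0 < ν) : ∀ᶠ x in 𝓝[>] 0, 0 < SI ν x := by
  have hG := Real.Gamma_pos_of_pos (by linarith : 0 < ν+1)
  have h := (SI_lim0 ν).eventually_const_lt (by positivity : (0:ℝ) < 2^(-ν) * (Real.Gamma (ν+1))⁻¹)
  filter_upwards [h, self_mem_nhdsWithin] with x h1 hx
  have hx : (0:ℝ) < x := hx
  exact (pos_iff_pos_of_mul_pos h1).1 (by positivity)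

lemma GS_pos0 {ν : ℝ} (hν : 0 < ν) : ∀ᶠ x in 𝓝[>] 0, 0 < GS ν x := by
  have hG := Real.Gamma_pos_of_pos (by linarith : 0 < ν+1)
  have hx2 : Tendsto (fun x : ℝ => x^2) (𝓝[>] 0) (𝓝 0) := by
    have : Tendsto (fun x : ℝ => x^2) (𝓝 0) (𝓝 (0^2)) := (continuous_pow 2).tendsto 0
    rw [zero_pow two_ne_zero] at this
    exact this.mono_left nhdsWithin_le_nhds
  have hl := ((SI_lim0 ν).const_mul ν).sub (hx2.mul (SI_lim0 (ν+1)))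
  rw [zero_mul, sub_zero] at hl
  have h := hl.eventually_const_lt (by positivity : (0:ℝ) < ν * (2^(-ν) * (Real.Gamma (ν+1))⁻¹))
  filter_upwards [h, self_mem_nhdsWithin] with x h1 hx
  have hx : (0:ℝ) < x := hx
  have e : ν * (x^(-ν) * SI ν x) - x^2 * (x^(-(ν+1)) * SI (ν+1) x) = x^(-ν) * GS ν x := by
    unfold GS
    rw [show -(ν+1) = -ν - 1 by ring, Real.rpow_sub hx, Real.rpow_one]
    field_simp
  rw [e] at h1
  exact (pos_iff_pos_of_mul_pos h1).1 (by positivity)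

lemma TI_atBot {μ : ℝ} (hμ : 0 < μ) : Tendsto (TI μ) (𝓝[>] 0) atBot := by
  have hG := Real.Gamma_pos_of_pos hμ
  have hB : Tendsto (fun x => BI (-μ) x) (𝓝[>] 0) atTop := by
    have h1 : Tendsto (fun x : ℝ => (x^μ)⁻¹) (𝓝[>] 0) atTop := by
      apply Tendsto.inv_tendsto_nhdsGT_zero
      refine tendsto_nhdsWithin_iff.2 ⟨rpow_lim_zero hμ, ?_⟩
      filter_upwards [self_mem_nhdsWithin] with x hx
      have hx : (0:ℝ) < x := hx
      exact (by positivity : 0 < x^μ)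
    refine (h1.atTop_mul_pos (by positivity : (0:ℝ) < 2^μ * Real.Gamma μ) (BI_lim μ hμ)).congr' ?_
    filter_upwards [self_mem_nhdsWithin] with x hx
    have hx : (0:ℝ) < x := hx
    have : 0 < x^μ := by positivity
    field_simp
  have h2 : Tendsto (fun x => (π + 1/μ - BI (-μ) x)/π) (𝓝[>] 0) atBot := by
    apply Tendsto.atBot_div_const Real.pi_pos
    simp only [sub_eq_add_neg]
    exact tendsto_atBot_add_const_left _ _ (tendsto_neg_atTop_atBot.comp hB)
  refine tendsto_atBot_mono' _ ?_ h2
  filter_upwards [self_mem_nhdsWithin] with x hx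
  have hx : (0:ℝ) < x := hx
  unfold TI
  apply div_le_div_of_nonneg_right _ Real.pi_pos.le
  have h3 := (le_abs_self _).trans (AI_abs_le (-(π/2)) μ x)
  have h4 := BI_le' hx hμ
  have h5 := mul_le_mul_of_nonneg_right (Real.neg_one_le_cos (μ*π)) (BI_nonneg μ x)
  linarith

lemma TI_neg0 {μ : ℝ} (hμ : 0 < μ) : ∀ᶠ x in 𝓝[>] 0, TI μ x < 0 := (TI_atBot hμ).eventually_lt_atBot 0

/-- arbitrarily small points where `T < 0` and `T` increases -/
lemma TI_point {μ : ℝ} (hμ : 0 < μ) {P : ℝ → Prop} (hP : ∀ᶠ x in 𝓝[>] 0, P x) : ∃ x, 0 < x ∧ P x ∧ TI μ x < 0 ∧ 0 < GT μ x := by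
  obtain ⟨u, hu, hu2⟩ := (mem_nhdsGT_iff_exists_Ioo_subset).1 (hP.and (TI_neg0 hμ))
  have hu : (0:ℝ) < u := hu
  obtain ⟨y, hy1, hy2⟩ := (((TI_atBot hμ).eventually_lt_atBot (TI μ (u/2))).and (Ioo_mem_nhdsGT (by positivity : 0 < u/2))).exists
  have hy2 : y ∈ Ioo 0 (u/2) := hy2
  obtain ⟨c, hc, hc2⟩ := exists_hasDerivAt_eq_slope (TI μ) (fun x => GT μ x / x) hy2.2
    (fun x hx => ((solT μ).cont (lt_of_lt_of_le hy2.1 hx.1)).continuousWithinAt) (fun x hx => (solT μ).d1 x (hy2.1.trans hx.1))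
  have hc0 : 0 < c := hy2.1.trans hc.1
  have h1 := hu2 (show c ∈ Ioo 0 u from ⟨hc0, by linarith [hc.2]⟩)
  refine ⟨c, hc0, h1.1, h1.2, ?_⟩
  have h2 : 0 < GT μ c / c := by
    rw [hc2]; exact div_pos (by linarith) (by linarith [hy2.2])
  have := mul_pos h2 hc0
  rwa [div_mul_cancel₀ _ hc0.ne'] at this

lemma Wr_eq (ν μ x : ℝ) : Wr ν μ x = GS ν x * TI μ x - SI ν x * GT μ x := rfl

lemma Wr_neg_point {ν μ : ℝ} (hν : 0 < ν) (hμ : 0 < μ) {P : ℝ → Prop} (hP : ∀ᶠ x in 𝓝[>] 0, P x) :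
    ∃ x, 0 < x ∧ P x ∧ Wr ν μ x < 0 := by
  obtain ⟨x, hx, ⟨h1, h2, h3⟩, h4, h5⟩ := TI_point hμ (hP.and ((SI_pos0 hν).and (GS_pos0 hν)))
  refine ⟨x, hx, h1, ?_⟩
  rw [Wr_eq]
  have := mul_neg_of_pos_of_neg h3 h4
  have := mul_pos h2 h5
  linarith

lemma Wr_const {μ : ℝ} (hμ : 0 < μ) : ∃ ω < 0, ∀ x, 0 < x → Wr μ μ x = ω := by
  obtain ⟨x0, hx0, _, h0⟩ := Wr_neg_point hμ hμ (P := fun _ => True) (Eventually.of_forall fun _ => trivial)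
  refine ⟨_, h0, fun x hx => ?_⟩
  have hd : ∀ x, 0 < x → HasDerivAt (Wr μ μ) 0 x := by
    intro x hx
    exact ((solS μ).wr (solT μ) hx).congr_deriv (by rw [sub_self, zero_div, zero_mul])
  refine IsOpen.is_const_of_deriv_eq_zero isOpen_Ioi isPreconnected_Ioi (s := Ioi (0:ℝ)) ?_ ?_ hx hx0
  · exact fun y hy => (hd y hy).differentiableAt.differentiableWithinAt
  · exact fun y hy => (hd y hy).deriv

lemma simpleS {ν : ℝ} (hν : 0 < ν) : ∀ x, 0 < x → SI ν x = 0 → GS ν x ≠ 0 := by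
  intro x hx h0 h1
  obtain ⟨ω, hω, h⟩ := Wr_const hν
  have := h x hx
  rw [Wr_eq, h0, h1] at this
  linarith
lemma simpleT {ν : ℝ} (hν : 0 < ν) : ∀ x, 0 < x → TI ν x = 0 → GT ν x ≠ 0 := by
  intro x hx h0 h1
  obtain ⟨ω, hω, h⟩ := Wr_const hν
  have := h x hx
  rw [Wr_eq, h0, h1] at this
  linarith

lemma ev_to {P : ℝ → Prop} (hP : ∀ᶠ x in 𝓝[>] 0, P x) : ∃ ε > 0, ∀ x : ℝ, 0 < x → x ≤ ε → P x := by
  obtain ⟨u, hu, hu2⟩ := (mem_nhdsGT_iff_exists_Ioo_subset).1 hP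
  have hu : (0:ℝ) < u := hu
  exact ⟨u/2, by positivity, fun x h1 h2 => hu2 ⟨h1, by linarith⟩⟩

lemma enumS (ν : ℝ) (hν : 0 < ν) : ∃ z, ZEnum (SI ν) z :=
  exists_ZEnum (solS ν) (simpleS hν) (ev_to ((SI_pos0 hν).mono fun _ h => h.ne'))
lemma enumT (ν : ℝ) (hν : 0 < ν) : ∃ z, ZEnum (TI ν) z :=
  exists_ZEnum (solT ν) (simpleT hν) (ev_to ((TI_neg0 hν).mono fun _ h => h.ne))

lemma S_init {ν : ℝ} (hν : 0 < ν) {b : ℝ} (hb : ∀ x, 0 < x → x < b → SI ν x ≠ 0) : ∀ x, 0 < x → x < b → 0 < SI ν x := by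
  intro x hx hxb
  rcases sign_const (s := Ioo 0 b) ordConnected_Ioo (fun x hx => ((solS ν).cont hx.1).continuousWithinAt) (fun x hx => hb x hx.1 hx.2) with s | s
  · exact s x ⟨hx, hxb⟩
  · exfalso
    obtain ⟨y, h1, h2⟩ := ((SI_pos0 hν).and (Ioo_mem_nhdsGT (hx.trans hxb))).exists
    have := s y h2
    linarith
lemma T_init {ν : ℝ} (hν : 0 < ν) {b : ℝ} (hb : ∀ x, 0 < x → x < b → TI ν x ≠ 0) : ∀ x, 0 < x → x < b → TI ν x < 0 := by
  intro x hx hxb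
  rcases sign_const (s := Ioo 0 b) ordConnected_Ioo (fun x hx => ((solT ν).cont hx.1).continuousWithinAt) (fun x hx => hb x hx.1 hx.2) with s | s
  · exfalso
    obtain ⟨y, h1, h2⟩ := ((TI_neg0 hν).and (Ioo_mem_nhdsGT (hx.trans hxb))).exists
    have := s y h2
    linarith
  · exact s x ⟨hx, hxb⟩

/-- the first zero of `T_μ` precedes that of `S_ν` when `ν > μ`. -/
lemma first_le {ν μ : ℝ} (hμ : 0 < μ) (hνμ : μ < ν) {j y : ℕ → ℝ} (hj : ZEnum (SI ν) j) (hy : ZEnum (TI μ) y) : y 0 ≤ j 0 := by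
  by_contra hc
  push Not at hc
  have hν : 0 < ν := hμ.trans hνμ
  have hT := T_init hμ hy.first
  have hS := S_init hν hj.first
  have hj0 := hj.pos 0
  obtain ⟨x0, hx0, hx1, hW⟩ := Wr_neg_point hν hμ (P := fun x => x < j 0)
    (mem_nhdsWithin_of_mem_nhds (Iio_mem_nhds hj0))
  have hd : ∀ x, 0 < x → HasDerivAt (Wr ν μ) ((ν^2-μ^2)/x * (SI ν x * TI μ x)) x := fun x hx => (solS ν).wr (solT μ) hx
  have hanti : AntitoneOn (Wr ν μ) (Icc x0 (j 0)) := by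
    apply antitoneOn_of_deriv_nonpos (convex_Icc _ _)
    · exact fun x hx => (hd x (lt_of_lt_of_le hx0 hx.1)).continuousAt.continuousWithinAt
    · rw [interior_Icc]; exact fun x hx => (hd x (hx0.trans hx.1)).differentiableAt.differentiableWithinAt
    · rw [interior_Icc]; intro x hx
      have hxp := hx0.trans hx.1
      rw [(hd x hxp).deriv]
      have h1 := hS x hxp hx.2
      have h2 := hT x hxp (hx.2.trans hc)
      have h3 : 0 ≤ (ν^2-μ^2)/x := div_nonneg (by nlinarith) hxp.le
      exact mul_nonpos_of_nonneg_of_nonpos h3 (mul_neg_of_pos_of_neg h1 h2).le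
  have h1 := hanti ⟨le_rfl, hx1.le⟩ ⟨hx1.le, le_rfl⟩ hx1.le
  rw [Wr_eq ν μ (j 0), hj.zero 0] at h1
  have h2 := (solS ν).G_nonpos (a := 0) hj0 hj0 (hj.zero 0) (fun x hx => (hS x hx.1 hx.2).le)
  have h3 := mul_nonneg_of_nonpos_of_nonpos h2 (hT _ hj0 hc).le
  linarith

/-- Rolle: zeros of `S_ν` precede those of `S_{ν+1}`. -/
lemma rolle_le {ν : ℝ} (hν : 0 < ν) {a b : ℕ → ℝ} (ha : ZEnum (SI ν) a) (hb : ZEnum (SI (ν+1)) b) : ∀ k, a k ≤ b k := by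
  have hd : ∀ x, 0 < x → HasDerivAt (fun x => x^(ν+1) * SI (ν+1) x) (x^(ν+1) * SI ν x) x := by
    intro x hx
    have h := (cyl_SI (ν+1) x hx).2
    rw [add_sub_cancel_right] at h
    refine ((Real.hasDerivAt_rpow_const (Or.inl hx.ne')).mul h).congr_deriv ?_
    rw [Real.rpow_sub hx, Real.rpow_one]
    field_simp
    ring
  have hzero : ∀ c, 0 < c → c^(ν+1) * SI ν c = 0 → SI ν c = 0 := by
    intro c hc h
    rcases mul_eq_zero.1 h with h | h
    · exact absurd h (by positivity)
    · exact h
  have hval : ∀ k, (b k)^(ν+1) * SI (ν+1) (b k) = 0 := fun k => by rw [hb.zero, mul_zero]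
  apply enum_le hb.pos ha
  · have h0 : Tendsto (fun x => x^(ν+1) * SI (ν+1) x) (𝓝[>] 0) (𝓝 0) := by
      have h := (rpow_lim_zero (by linarith : 0 < (ν+1)+(ν+1))).mul (SI_lim0 (ν+1))
      rw [zero_mul] at h
      refine h.congr' ?_
      filter_upwards [self_mem_nhdsWithin] with x hx
      have hx : (0:ℝ) < x := hx
      rw [Real.rpow_add hx, Real.rpow_neg hx.le]
      field_simp
    have h1 : Tendsto (fun x => x^(ν+1) * SI (ν+1) x) (𝓝[<] (b 0)) (𝓝 0) := by
      have := (hd _ (hb.pos 0)).continuousAt.tendsto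
      rw [hval 0] at this
      exact this.mono_left nhdsWithin_le_nhds
    obtain ⟨c, hc, hc0⟩ := exists_hasDerivAt_eq_zero' (hb.pos 0) h0 h1 (fun x hx => hd x hx.1)
    by_contra hlt
    push Not at hlt
    exact ha.first c hc.1 (hc.2.trans hlt) (hzero c hc.1 hc0)
  · intro k
    have hlt := hb.mono (Nat.lt_succ_self k)
    obtain ⟨c, hc, hc0⟩ := exists_hasDerivAt_eq_zero hlt
      (fun x hx => (hd x (lt_of_lt_of_le (hb.pos k) hx.1)).continuousAt.continuousWithinAt)
      (by rw [hval, hval]) (fun x hx => hd x ((hb.pos k).trans hx.1))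
    exact ⟨c, hc, hzero c ((hb.pos k).trans hc.1) hc0⟩

lemma final_contra {ν μ : ℝ} (hν : 0 < ν) (hμ : 0 < μ) (h1 : 1 < |ν - μ|) (h2 : |ν - μ| ≤ 2) {j y : ℕ → ℝ}
    (hj : ZEnum (SI ν) j) (hy : ZEnum (TI μ) y) (hle : ∀ k, y k ≤ j k) (hle2 : ∀ k, j k ≤ y (k+1)) : False := by
  obtain ⟨ω, hω, hW⟩ := Wr_const hμ
  have hlim := (Wr_lim ν μ ω hW).comp hj.top
  have hcos : Real.cos ((ν-μ)*π/2) < 0 := by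
    rw [← Real.cos_abs, abs_div, abs_mul, abs_of_pos Real.pi_pos, abs_two]
    have := Real.pi_pos
    apply Real.cos_neg_of_pi_div_two_lt_of_lt <;> nlinarith
  have hpos : 0 < ω * Real.cos ((ν-μ)*π/2) := mul_pos_of_neg_of_neg hω hcos
  have hnon : ω * Real.cos ((ν-μ)*π/2) ≤ 0 := by
    refine le_of_tendsto hlim (Eventually.of_forall fun k => ?_)
    simp only [Function.comp]
    rw [Wr_eq, hj.zero, zero_mul, sub_zero]
    have s1 := (sign_G (solS ν) (simpleS hν) hj (S_init hν hj.first) k).1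
    have hyn : ZEnum (fun x => - TI μ x) y := ⟨hy.mono, hy.pos, fun k => by simp [hy.zero], fun x a b => by simpa using hy.first x a b,
      fun k x hx => by simpa using hy.gap k x hx, hy.top⟩
    have s2 := (sign_G (solT μ).neg (fun x hx h0 => by simpa using simpleT hμ x hx (by simpa using h0)) hyn
      (fun x a b => by have := T_init hμ hy.first x a b; linarith) k).2 (j k) ⟨hle k, hle2 k⟩
    rcases neg_one_pow_eq_or ℝ k with e | e
    · rw [pow_succ, e] at s2
      rw [e] at s1
      exact mul_nonpos_of_nonpos_of_nonneg (by linarith) (by linarith)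
    · rw [pow_succ, e] at s2
      rw [e] at s1
      exact mul_nonpos_of_nonneg_of_nonpos (by linarith) (by linarith)
  linarith

lemma shift_nat {d : ℝ} (hd : 1 < d) : ∃ n : ℕ, 1 < d - n ∧ d - n ≤ 2 := by
  refine ⟨⌈d-2⌉₊, ?_, by have := Nat.le_ceil (d-2); linarith⟩
  by_cases h : d ≤ 2
  · rw [Nat.ceil_eq_zero.2 (by linarith)]; simpa using hd
  · have := Nat.ceil_lt_add_one (by linarith : 0 ≤ d-2); linarith

lemma main_contra {ν μ : ℝ} (hν : 0 < ν) (hμ : 0 < μ) (hsep : 1 < |ν - μ|) {j y : ℕ → ℝ}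
    (hj : ZEnum (SI ν) j) (hy : ZEnum (TI μ) y) (hyj : y 0 ≤ j 0)
    (h1 : ∀ k, ∃ x ∈ Ioo (j k) (j (k+1)), TI μ x = 0) (h2 : ∀ k, ∃ x ∈ Ioo (y k) (y (k+1)), SI ν x = 0) : False := by
  have a1 : ∀ k, y k ≤ j k := enum_le hj.pos hy hyj h1
  have a2 : ∀ k, j k ≤ y (k+1) := enum_le_succ hy.pos hj h2
  have hup : ∀ n : ℕ, ∀ α, 0 < α → ∀ a b, ZEnum (SI α) a → ZEnum (SI (α + (n+1:ℕ))) b → ∀ k, a k ≤ b k := by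
    intro n
    induction n with
    | zero => intro α hα a b ha hb; exact rolle_le hα ha (by simpa using hb)
    | succ n ih =>
      intro α hα a b ha hb k
      obtain ⟨c, hc⟩ := enumS (α + (n+1:ℕ)) (by positivity)
      refine (ih α hα a c ha hc k).trans (rolle_le (by positivity) hc ?_ k)
      rwa [show α + ((n+1:ℕ):ℝ) + 1 = α + ((n+1+1:ℕ):ℝ) by push_cast; ring]
  rcases lt_abs.1 hsep with hA | hB
  · obtain ⟨n, hn1, hn2⟩ := shift_nat hA
    cases n with
    | zero =>
      refine final_contra hν hμ hsep ?_ hj hy a1 a2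
      rw [abs_of_pos (by linarith)]; simpa using hn2
    | succ n =>
      set ν' := ν - (n+1:ℕ) with hν'
      have hν0 : 0 < ν' := by linarith
      obtain ⟨c, hc⟩ := enumS ν' hν0
      have hcj := hup n ν' hν0 c j hc (by rwa [hν', sub_add_cancel])
      have e : ν' - μ = ν - μ - (n+1:ℕ) := by rw [hν']; ring
      refine final_contra hν0 hμ ?_ ?_ hc hy ?_ (fun k => (hcj k).trans (a2 k))
      · rw [e, abs_of_pos (by linarith)]; exact hn1
      · rw [e, abs_of_pos (by linarith)]; exact hn2
      · apply enum_le hc.pos hy (first_le hμ (by linarith) hc hy)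
        intro k
        exact sturm (solS ν') (solT μ) (by nlinarith) (hc.pos k) (hc.mono (Nat.lt_succ_self k)) (hc.zero _) (hc.zero _) (hc.gap k)
  · obtain ⟨n, hn1, hn2⟩ := shift_nat hB
    cases n with
    | zero =>
      refine final_contra hν hμ hsep ?_ hj hy a1 a2
      rw [abs_of_neg (by linarith)]; simpa using hn2
    | succ n =>
      set ν' := ν + (n+1:ℕ) with hν'
      have hν0 : 0 < ν' := by positivity
      obtain ⟨c, hc⟩ := enumS ν' hν0
      have hcj := hup n ν hν j c hj hc
      have e : ν' - μ = -(-(ν - μ) - (n+1:ℕ)) := by rw [hν']; ring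
      refine final_contra hν0 hμ ?_ ?_ hc hy (fun k => (a1 k).trans (hcj k)) ?_
      · rw [e, abs_neg, abs_of_pos (by linarith)]; exact hn1
      · rw [e, abs_neg, abs_of_pos (by linarith)]; exact hn2
      · apply enum_le_succ hy.pos hc
        intro k
        exact sturm (solT μ) (solS ν') (by nlinarith) (hy.pos k) (hy.mono (Nat.lt_succ_self k)) (hy.zero _) (hy.zero _) (hy.gap k)

theorem besselJ_besselY_not_interlaced (ν μ : ℝ) (hν : 0 < ν) (hμ : 0 < μ)
    (hsep : 1 < |ν - μ|)
    (j₁ y₁ : ℝ)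
    (hj₁ : IsLeast {x : ℝ | 0 < x ∧ besselJ ν x = 0} j₁)
    (hy₁ : IsLeast {x : ℝ | 0 < x ∧ besselY μ x = 0} y₁)
    (hlt : y₁ < j₁) :
    ¬ InterlacedOn (besselJ ν) (besselY μ) (Set.Ioi 0) := by
  rintro ⟨hI1, hI2⟩
  obtain ⟨j, hj⟩ := enumS ν hν
  obtain ⟨y, hy⟩ := enumT μ hμ
  refine main_contra hν hμ hsep hj hy ?_ ?_ ?_
  · have e1 : j₁ ≤ j 0 := hj₁.2 ⟨hj.pos 0, by rw [SI_eq_J _ (hj.pos 0)]; exact hj.zero 0⟩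
    have e2 : y 0 ≤ y₁ := by
      by_contra hc
      push Not at hc
      refine hy.first y₁ hy₁.1.1 hc ?_
      rw [← TI_eq_Y _ hy₁.1.1]; exact hy₁.1.2
    linarith
  · intro k
    have hlt := hj.mono (Nat.lt_succ_self k)
    obtain ⟨x, ⟨hx1, hx2⟩, _⟩ := hI1 (j k) (hj.pos k) (j (k+1)) (hj.pos (k+1)) hlt
      (by rw [SI_eq_J _ (hj.pos _)]; exact hj.zero k) (by rw [SI_eq_J _ (hj.pos _)]; exact hj.zero (k+1))
      (fun x hx => by rw [SI_eq_J _ ((hj.pos k).trans hx.1)]; exact hj.gap k x hx)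
    exact ⟨x, hx1, by rwa [TI_eq_Y _ ((hj.pos k).trans hx1.1)] at hx2⟩
  · intro k
    have hlt := hy.mono (Nat.lt_succ_self k)
    obtain ⟨x, ⟨hx1, hx2⟩, _⟩ := hI2 (y k) (hy.pos k) (y (k+1)) (hy.pos (k+1)) hlt
      (by rw [TI_eq_Y _ (hy.pos _)]; exact hy.zero k) (by rw [TI_eq_Y _ (hy.pos _)]; exact hy.zero (k+1))
      (fun x hx => by rw [TI_eq_Y _ ((hy.pos k).trans hx.1)]; exact hy.gap k x hx)
    exact ⟨x, hx1, by rwa [SI_eq_J _ ((hy.pos k).trans hx1.1)] at hx2⟩
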